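/- For every positive rational number q there are infinitely many positive integers n such that d(n+1)/d(n) = q, where d denotes the number-of-divisors function. -/

import Mathlib

/-- `d n` is the number of positive divisors of `n`. -/
def d (n : ℕ) : ℕ := n.divisors.card

theorem d_mul_of_coprime {a b : ℕ} (h : a.Coprime b) : d (a * b) = d a * d b :=
  h.card_divisors_mul

theorem d_prime_pow {p : ℕ} (hp : p.Prime) (k : ℕ) : d (p ^ k) = k + 1 := by
  simp [d, Nat.divisors_prime_pow hp]

theorem d_pos {n : ℕ} (h : 0 < n) : 0 < d n :=
  Finset.card_pos.mpr (Nat.nonempty_divisors.mpr h.ne')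

theorem exists_modEq_of_pairwise_coprime {ι : Type*} (S : Finset ι) (c s : ι → ℕ)
    (hs : ∀ i ∈ S, s i ≠ 0) (hco : ∀ i ∈ S, ∀ j ∈ S, i ≠ j → (s i).Coprime (s j)) :
    ∃ y, ∀ i ∈ S, y ≡ c i [MOD s i] :=
  ⟨_, (Nat.chineseRemainderOfFinset c s S hs fun i hi j hj hij => hco i hi j hj hij).2⟩

/-- A prime dividing the difference of two members of a family in which differences divide
the members also divides their product. -/
theorem prime_dvd_prod_of_dvd_sub {n : ℕ} {X : Fin n → ℕ} (hinj : Function.Injective X)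
    (hdiv : ∀ i j, X i < X j → X j - X i ∣ X i) {p : ℕ} {i j : Fin n}
    (hij : i ≠ j) (h : (p : ℤ) ∣ (X i : ℤ) - X j) : p ∣ ∏ k, X k := by
  rcases lt_or_gt_of_ne (hinj.ne hij) with hlt | hlt
  · have h1 : p ∣ X j - X i := by
      rw [← Int.natCast_dvd_natCast, Nat.cast_sub hlt.le, ← dvd_neg, neg_sub]
      exact h
    exact (h1.trans (hdiv i j hlt)).trans (Finset.dvd_prod_of_mem X (Finset.mem_univ i))
  · have h1 : p ∣ X i - X j := by
      rw [← Int.natCast_dvd_natCast, Nat.cast_sub hlt.le]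
      exact h
    exact (h1.trans (hdiv j i hlt)).trans (Finset.dvd_prod_of_mem X (Finset.mem_univ j))

theorem exists_injective_primes (n M : ℕ) :
    ∃ p : Fin n → ℕ, (∀ i, (p i).Prime) ∧ Function.Injective p ∧ ∀ i, M < p i := by
  refine ⟨fun i => Nat.nth Nat.Prime (M + i), fun i => Nat.prime_nth_prime _, ?_, fun i => ?_⟩
  · intro i j h
    have := Nat.nth_injective Nat.infinite_setOfPred_prime h
    exact Fin.ext (by omega)
  · have := Nat.add_two_le_nth_prime (M + i)
    show M < Nat.nth Nat.Prime (M + i)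
    omega

/-- Shifting a family by a suitable arithmetic progression multiplies its members by prescribed
powers of new primes and by linear forms without small prime factors. -/
theorem exists_shift {n : ℕ} {X : Fin n → ℕ} (hX : ∀ i, 0 < X i)
    (hinj : Function.Injective X) (hdiv : ∀ i j, X i < X j → X j - X i ∣ X i)
    (m : Fin n → ℕ) (hm : ∀ i, 1 ≤ m i) {R : ℕ} (hR : 0 < R) :
    ∃ (p A B : Fin n → ℕ) (Y Q : ℕ), 0 < Q ∧ R * ∏ k, X k ∣ Q ∧ (∀ i, (p i).Prime) ∧
      Function.Injective p ∧ (∀ i, (p i).Coprime (R * ∏ k, X k)) ∧ (∀ i, p i ∣ Q) ∧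
      (∀ i, A i ∣ Q) ∧ (∀ i t, X i + (Y + t * Q) = X i * p i ^ m i * (A i * t + B i)) ∧
      ∀ i t, (A i * t + B i).Coprime Q := by
  set M := R * ∏ k, X k with hM
  have hM0 : 0 < M := Nat.mul_pos hR (Finset.prod_pos fun i _ => hX i)
  obtain ⟨p, hp, hpinj, hpM⟩ := exists_injective_primes n M
  have hpcop : ∀ i, (p i).Coprime M := fun i =>
    ((hp i).coprime_iff_not_dvd).2 fun h => absurd (Nat.le_of_dvd hM0 h) (not_le.2 (hpM i))
  have hpp : ∀ i j, i ≠ j → (p i).Coprime (p j) := fun i j hij =>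
    (Nat.coprime_primes (hp i) (hp j)).2 (hpinj.ne hij)
  obtain ⟨Y₁, hY₁⟩ := exists_modEq_of_pairwise_coprime Finset.univ
    (fun i => p i ^ m i + X i * (p i ^ (m i + 1) - 1)) (fun i => p i ^ (m i + 1))
    (fun i _ => pow_ne_zero _ (hp i).ne_zero)
    (fun i _ j _ hij => Nat.Coprime.pow _ _ (hpp i j hij))
  have hcop : (M * M).Coprime (∏ i, p i ^ (m i + 1)) :=
    Nat.Coprime.prod_right fun i _ => Nat.Coprime.pow_right _
      (Nat.Coprime.mul_left (hpcop i).symm (hpcop i).symm)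
  obtain ⟨Y, hY0, hYp⟩ := Nat.chineseRemainder hcop 0 Y₁
  have hY0' : M * M ∣ Y := (Nat.modEq_zero_iff_dvd).1 hY0
  set Q := M * M * ∏ i, p i ^ (m i + 1) with hQ
  have hPpos : 0 < ∏ i, p i ^ (m i + 1) := Finset.prod_pos fun i _ => pow_pos (hp i).pos _
  have hQ0 : 0 < Q := by positivity
  have hpQ : ∀ i, p i ^ (m i + 1) ∣ Q := fun i =>
    (Finset.dvd_prod_of_mem (fun i => p i ^ (m i + 1)) (Finset.mem_univ i)).mul_left _
  have hMQ : M * M ∣ Q := Dvd.intro _ rfl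
  have hXM : ∀ i, X i ∣ M := fun i =>
    (Finset.dvd_prod_of_mem X (Finset.mem_univ i)).mul_left _
  have hYX : ∀ i, X i + Y ≡ p i ^ m i [MOD p i ^ (m i + 1)] := by
    intro i
    have h1 : Y ≡ p i ^ m i + X i * (p i ^ (m i + 1) - 1) [MOD p i ^ (m i + 1)] :=
      (hYp.of_dvd (Finset.dvd_prod_of_mem (fun i => p i ^ (m i + 1)) (Finset.mem_univ i))).trans
        (hY₁ i (Finset.mem_univ i))
    have h2 : X i + (p i ^ m i + X i * (p i ^ (m i + 1) - 1))
        = p i ^ m i + p i ^ (m i + 1) * X i := by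
      obtain ⟨k, hk⟩ := Nat.exists_eq_succ_of_ne_zero (pow_ne_zero (m i + 1) (hp i).ne_zero)
      rw [hk, Nat.succ_sub_one, Nat.succ_eq_add_one]
      ring
    calc X i + Y ≡ X i + (p i ^ m i + X i * (p i ^ (m i + 1) - 1)) [MOD p i ^ (m i + 1)] :=
          Nat.ModEq.add_left _ h1
      _ = p i ^ m i + p i ^ (m i + 1) * X i := h2
      _ ≡ p i ^ m i [MOD p i ^ (m i + 1)] := by simp [Nat.ModEq]
  have hXp : ∀ i, (X i).Coprime (p i ^ m i) := fun i =>
    Nat.Coprime.pow_right _ ((hpcop i).symm.coprime_dvd_left (hXM i))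
  have hdQ : ∀ i, X i * p i ^ m i ∣ Q := fun i =>
    mul_dvd_mul ((hXM i).trans (Dvd.intro _ rfl))
      ((pow_dvd_pow _ (Nat.le_succ _)).trans
        (Finset.dvd_prod_of_mem (fun i => p i ^ (m i + 1)) (Finset.mem_univ i)))
  have hdY : ∀ i, X i * p i ^ m i ∣ X i + Y := fun i =>
    (hXp i).mul_dvd_of_dvd_of_dvd
      (dvd_add dvd_rfl ((hXM i).trans ((Dvd.intro _ rfl).trans hY0')))
      (((hYX i).dvd_iff (pow_dvd_pow _ (Nat.le_succ _))).2 dvd_rfl)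
  choose A hA using hdQ
  choose B hB using hdY
  have hform : ∀ i t, X i + (Y + t * Q) = X i * p i ^ m i * (A i * t + B i) := by
    intro i t
    rw [← add_assoc, hB i, hA i]
    ring
  refine ⟨p, A, B, Y, Q, hQ0, (Dvd.intro _ rfl).trans hMQ, hp, hpinj, hpcop,
    fun i => (dvd_pow_self _ (Nat.succ_ne_zero _)).trans (hpQ i),
    fun i => ⟨_, (hA i).trans (mul_comm _ _)⟩, hform, fun i t => ?_⟩
  have hcM : (A i * t + B i).Coprime M := by
    have h1 : X i * M ∣ Y + t * Q :=
      (mul_dvd_mul (hXM i) dvd_rfl).trans (dvd_add hY0' (hMQ.mul_left t))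
    obtain ⟨k, hk⟩ := h1
    have h2 : p i ^ m i * (A i * t + B i) = 1 + M * k := by
      apply Nat.eq_of_mul_eq_mul_left (hX i)
      rw [← mul_assoc, ← hform i t, hk]
      ring
    have h3 : (1 + M * k).Coprime M := by simp
    rw [← h2] at h3
    exact h3.coprime_dvd_left (Dvd.intro_left _ rfl)
  have hcp : ∀ j, (A i * t + B i).Coprime (p j) := by
    intro j
    rw [Nat.coprime_comm, (hp j).coprime_iff_not_dvd]
    intro hdvd
    by_cases hij : i = j
    · subst hij
      have h1 : p i ^ (m i + 1) ∣ X i + (Y + t * Q) := by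
        rw [hform i t, pow_succ, mul_assoc (X i)]
        exact (mul_dvd_mul dvd_rfl hdvd).mul_left _
      rw [← add_assoc] at h1
      have h2 := (Nat.dvd_add_left ((hpQ i).mul_left t)).1 h1
      have h3 := ((hYX i).dvd_iff dvd_rfl).1 h2
      exact absurd ((Nat.pow_dvd_pow_iff_le_right (hp i).one_lt).1 h3) (by omega)
    · have h1 : p j ∣ X i + (Y + t * Q) := by
        rw [hform i t]
        exact hdvd.mul_left _
      have h2 : p j ∣ X j + (Y + t * Q) := by
        rw [hform j t]
        exact ((dvd_pow_self _ (by have := hm j; omega)).mul_left _).mul_right _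
      have h3 : (p j : ℤ) ∣ (X i : ℤ) - X j := by
        have := dvd_sub (Int.natCast_dvd_natCast.2 h1) (Int.natCast_dvd_natCast.2 h2)
        push_cast at this
        simpa using this
      exact (hp j).coprime_iff_not_dvd.1 (hpcop j)
        ((prime_dvd_prod_of_dvd_sub hinj hdiv hij h3).mul_left R)
  exact Nat.Coprime.mul_right (Nat.Coprime.mul_right hcM hcM)
    (Nat.Coprime.prod_right fun j _ => Nat.Coprime.pow_right _ (hcp j))

/-- A family of positive integers whose pairwise differences divide its members, such that the
divisor-count ratio of the two consecutive quotients coming from each pair of members is `q`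
up to weights. -/
structure IsBalanced (q : ℚ) {n : ℕ} (X : Fin n → ℕ) (w : Fin n → ℚ) : Prop where
  pos : ∀ i, 0 < X i
  inj : Function.Injective X
  weight_pos : ∀ i, 0 < w i
  dvd : ∀ i j, X i < X j → X j - X i ∣ X i
  ratio : ∀ i j, X i < X j →
    (d (X j / (X j - X i)) : ℚ) * w i = q * w j * d (X i / (X j - X i))

theorem exists_nat_mul_eq_const {n : ℕ} (v : Fin n → ℚ) (hv : ∀ i, 0 < v i) :
    ∃ (m : Fin n → ℕ) (K : ℚ), 0 < K ∧ ∀ i, 2 ≤ m i ∧ v i * m i = K := by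
  have hnum : ∀ i, 0 < (v i).num.toNat := fun i => by
    have := Rat.num_pos.2 (hv i)
    omega
  refine ⟨fun i => 2 * ((v i).den * ∏ j ∈ Finset.univ.erase i, (v j).num.toNat),
    2 * ∏ j, ((v j).num.toNat : ℚ), ?_, fun i => ⟨?_, ?_⟩⟩
  · exact mul_pos two_pos (Finset.prod_pos fun i _ => by exact_mod_cast hnum i)
  · have : 0 < (v i).den * ∏ j ∈ Finset.univ.erase i, (v j).num.toNat :=
      Nat.mul_pos (v i).den_pos (Finset.prod_pos fun j _ => hnum j)
    show 2 ≤ 2 * _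
    omega
  · rw [← Finset.mul_prod_erase Finset.univ _ (Finset.mem_univ i)]
    have h1 : v i * (v i).den = ((v i).num.toNat : ℚ) := by
      rw [Rat.mul_den_eq_num]
      have := (Rat.num_pos.2 (hv i)).le
      exact_mod_cast (Int.toNat_of_nonneg this).symm
    push_cast
    rw [← h1]
    ring

theorem exists_mul_modEq_one {a b : ℕ} (hb : 0 < b) (h : a.Coprime b) :
    ∃ t, t * a ≡ 1 [MOD b] := by
  rcases eq_or_ne b 1 with rfl | hb1
  · exact ⟨0, Nat.modEq_one⟩
  · obtain ⟨t, -, ht⟩ := Nat.exists_mul_mod_eq_one_of_coprime h (by omega)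
    refine ⟨t, ?_⟩
    rw [mul_comm, Nat.ModEq, ht, Nat.mod_eq_of_lt (by omega)]

/-- The cofactors in a shifted family are pairwise coprime. -/
theorem coprime_cofactors {n : ℕ} {X : Fin n → ℕ} (hinj : Function.Injective X)
    (hdiv : ∀ i j, X i < X j → X j - X i ∣ X i) {Y Q : ℕ} {c L : Fin n → ℕ}
    (hQ : ∏ k, X k ∣ Q) (hL : ∀ i, X i + Y = c i * L i) (hcop : ∀ i, (L i).Coprime Q)
    {i j : Fin n} (hij : i ≠ j) : (L i).Coprime (L j) := by
  refine Nat.Coprime.symm (Nat.coprime_of_dvd fun p hp hpj hpi => ?_)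
  have h3 : (p : ℤ) ∣ (X i : ℤ) - X j := by
    have h1 : p ∣ X i + Y := hL i ▸ hpi.mul_left _
    have h2 : p ∣ X j + Y := hL j ▸ hpj.mul_left _
    have := dvd_sub (Int.natCast_dvd_natCast.2 h1) (Int.natCast_dvd_natCast.2 h2)
    push_cast at this
    simpa using this
  exact Nat.not_coprime_of_dvd_of_dvd hp.one_lt hpi
    ((prime_dvd_prod_of_dvd_sub hinj hdiv hij h3).trans hQ) (hcop i)

theorem coprime_of_modEq_one {a b : ℕ} (h : a ≡ 1 [MOD b]) : a.Coprime b := by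
  have := h.gcd_eq
  simpa [Nat.Coprime] using this

theorem d_mul_div {x g u : ℕ} (hg : g ∣ x) (h : x.Coprime u) :
    d (x * u / g) = d (x / g) * d u := by
  rw [Nat.mul_comm, Nat.mul_div_assoc _ hg, d_mul_of_coprime, mul_comm]
  exact (h.coprime_dvd_left (Nat.div_dvd_of_dvd hg)).symm

/-- Multiplying by a common-shift cofactor changes the weights only. -/
theorem IsBalanced.shift {q : ℚ} {n : ℕ} {X : Fin n → ℕ} {w : Fin n → ℚ}
    (h : IsBalanced q X w) {Y : ℕ} {u : Fin n → ℕ} (hu : ∀ i, X i + Y = X i * u i)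
    (hcop : ∀ i, (X i).Coprime (u i)) (hpos : ∀ i, 0 < u i) :
    IsBalanced q (fun i => X i + Y) (fun i => w i * d (u i)) where
  pos i := Nat.add_pos_left (h.pos i) _
  inj i j hij := h.inj (Nat.add_right_cancel hij)
  weight_pos i := mul_pos (h.weight_pos i) (by exact_mod_cast d_pos (hpos i))
  dvd i j hij := by
    rw [Nat.add_sub_add_right, hu i]
    exact (h.dvd i j (by omega)).mul_right _
  ratio i j hij := by
    have hlt : X i < X j := by omega
    have hi := h.dvd i j hlt
    have hj : X j - X i ∣ X j := by
      have := dvd_add hi dvd_rfl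
      rwa [Nat.add_sub_cancel' hlt.le] at this
    rw [Nat.add_sub_add_right, hu i, hu j, d_mul_div hi (hcop i), d_mul_div hj (hcop j)]
    push_cast
    linear_combination ((d (u j) : ℚ) * d (u i)) * h.ratio i j hlt

theorem IsBalanced.extend {q : ℚ} (hq : 0 < q) {n : ℕ} {X : Fin n → ℕ} {w : Fin n → ℚ}
    (h : IsBalanced q X w) :
    ∃ (X' : Fin (n + 1) → ℕ) (w' : Fin (n + 1) → ℚ), IsBalanced q X' w' := by
  set M := 2 * ∏ k, X k with hM
  have hM0 : 0 < M := Nat.mul_pos two_pos (Finset.prod_pos fun i _ => h.pos i)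
  have hXM : ∀ i, X i ∣ ∏ k, X k := fun i => Finset.dvd_prod_of_mem X (Finset.mem_univ i)
  have hG : ∀ i, ∃ k, M * M = X i * (M * k) := fun i => by
    obtain ⟨k, hk⟩ := (hXM i).mul_left 2
    refine ⟨k, ?_⟩
    nth_rewrite 1 [hM]
    rw [hk]
    ring
  choose g hg using hG
  have hg0 : ∀ i, 0 < M * g i := fun i => Nat.pos_of_mul_pos_left (hg i ▸ Nat.mul_pos hM0 hM0)
  obtain ⟨m, K, hK, hmK⟩ := exists_nat_mul_eq_const (fun i => (d (M * g i) : ℚ) * w i)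
    fun i => mul_pos (by exact_mod_cast d_pos (hg0 i)) (h.weight_pos i)
  obtain ⟨p, A, L, Y, Q, hQ0, hMQ, hp, hpinj, hpM, hpQ, -, hform₀, hLQ₀⟩ :=
    exists_shift h.pos h.inj h.dvd m (fun i => one_le_two.trans (hmK i).1) two_pos
  have hform : ∀ i, X i + Y = X i * (p i ^ m i * L i) := fun i => by
    simpa [mul_assoc] using hform₀ i 0
  have hLQ : ∀ i, (L i).Coprime Q := fun i => by simpa using hLQ₀ i 0
  have hLM : ∀ i, (L i).Coprime M := fun i => (hLQ i).coprime_dvd_right hMQ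
  have hLp : ∀ i j, (L i).Coprime (p j) := fun i j => (hLQ i).coprime_dvd_right (hpQ j)
  have hLL : ∀ i j, i ≠ j → (L i).Coprime (L j) := fun i j hij =>
    coprime_cofactors h.inj h.dvd ((Dvd.intro_left _ rfl).trans hMQ)
      (fun i => by rw [hform i, ← mul_assoc]) hLQ hij
  have hpp : ∀ i j, i ≠ j → (p i).Coprime (p j) := fun i j hij =>
    (Nat.coprime_primes (hp i) (hp j)).2 (hpinj.ne hij)
  have hL0 : ∀ i, 0 < L i := fun i => Nat.pos_of_ne_zero fun h0 => by
    have h1 := hform i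
    have h2 := h.pos i
    rw [h0, mul_zero, mul_zero] at h1
    omega
  set e : Fin n → ℕ := fun i => m i * (m i + 1) - 1 with he
  have hem : ∀ i, ∃ k, e i = m i + (k + 1) ∧ k + 2 = m i * m i := fun i => by
    have h2 := (hmK i).1
    have h3 : 4 ≤ m i * m i := Nat.mul_le_mul h2 h2
    refine ⟨m i * m i - 2, ?_, by omega⟩
    simp only [he, mul_add, mul_one]
    omega
  choose k hek hk using hem
  set S := ∏ i, p i ^ e i with hS
  set Λ := ∏ i, L i with hΛ
  set S' : Fin n → ℕ := fun i => ∏ j ∈ Finset.univ.erase i, p j ^ e j with hS'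
  set Λ' : Fin n → ℕ := fun i => ∏ j ∈ Finset.univ.erase i, L j with hΛ'
  have hSS' : ∀ i, S = p i ^ e i * S' i := fun i =>
    (Finset.mul_prod_erase _ _ (Finset.mem_univ i)).symm
  have hΛΛ' : ∀ i, Λ = L i * Λ' i := fun i =>
    (Finset.mul_prod_erase _ _ (Finset.mem_univ i)).symm
  set σ : Fin n → ℕ := fun i => M * g i * (p i ^ (k i + 1) * S' i) * Λ' i with hσ
  have hP : ∀ i, M * M * S * Λ = (X i + Y) * σ i := fun i => by
    rw [hg i, hSS' i, hΛΛ' i, hform i, hek i, hσ]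
    ring
  have hpS' : ∀ i, (p i).Coprime (S' i) := fun i => Nat.Coprime.prod_right fun j hj =>
    Nat.Coprime.pow_right _ (hpp i j (Finset.ne_of_mem_erase hj).symm)
  have hLΛ' : ∀ i, (L i).Coprime (Λ' i) := fun i => Nat.Coprime.prod_right fun j hj =>
    hLL i j (Finset.ne_of_mem_erase hj).symm
  have hLS : ∀ i, (L i).Coprime S := fun i => Nat.Coprime.prod_right fun j _ =>
    Nat.Coprime.pow_right _ (hLp i j)
  have hLMS : ∀ i, (L i).Coprime (M * M * S) := fun i =>
    Nat.Coprime.mul_right (Nat.Coprime.mul_right (hLM i) (hLM i)) (hLS i)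
  have hgM : ∀ i, M * g i ∣ M * M := fun i => ⟨X i, by rw [hg i]; ring⟩
  have hkS : ∀ i, p i ^ (k i + 1) * S' i ∣ S := fun i => by
    rw [hSS' i]
    exact mul_dvd_mul (pow_dvd_pow _ (by rw [hek i]; omega)) dvd_rfl
  have hσL : ∀ i, (σ i).Coprime (L i) := fun i =>
    Nat.Coprime.mul_left
      ((hLMS i).symm.coprime_dvd_left (mul_dvd_mul (hgM i) (hkS i))) (hLΛ' i).symm
  have hinv : ∀ i, ∃ t, t * σ i ≡ 1 [MOD L i] := fun i =>
    exists_mul_modEq_one (hL0 i) (hσL i)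
  choose τ hτ using hinv
  obtain ⟨t₁, ht₁⟩ := exists_modEq_of_pairwise_coprime Finset.univ τ L
    (fun i _ => (hL0 i).ne') (fun i _ j _ hij => hLL i j hij)
  obtain ⟨t, ht0, htL⟩ := Nat.chineseRemainder
    (Nat.Coprime.prod_right fun i (_ : i ∈ Finset.univ) => (hLMS i).symm) 1 t₁
  have htMS : t.Coprime (M * M * S) := coprime_of_modEq_one ht0
  have htσ : ∀ i, t * σ i ≡ 1 [MOD L i] := fun i =>
    (((htL.of_dvd (Finset.dvd_prod_of_mem L (Finset.mem_univ i))).trans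
      (ht₁ i (Finset.mem_univ i))).mul_right _).trans (hτ i)
  have htΛ : t.Coprime Λ := Nat.Coprime.prod_right fun i _ =>
    (coprime_of_modEq_one (htσ i)).coprime_dvd_left (Dvd.intro _ rfl)
  have ht : 0 < t := Nat.pos_of_ne_zero fun h0 => by
    rw [h0, Nat.coprime_zero_left] at htMS
    have : M ∣ 1 := htMS ▸ ((Dvd.intro M rfl).mul_right S)
    have := (Nat.dvd_one.1 this)
    omega
  have hS0 : 0 < S := Finset.prod_pos fun i _ => pow_pos (hp i).pos _
  have hΛ0 : 0 < Λ := Finset.prod_pos fun i _ => hL0 i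
  set P := M * M * S * Λ * t with hPdef
  have hP0 : 0 < P := by positivity
  have hPσ : ∀ i, P = (X i + Y) * (σ i * t) := fun i => by
    rw [hPdef, hP i, mul_assoc]
  have hb₁ : IsBalanced q (fun i => X i + Y) (fun i => w i * d (p i ^ m i * L i)) := by
    refine h.shift hform (fun i => ?_) (fun i => Nat.mul_pos (pow_pos (hp i).pos _) (hL0 i))
    exact Nat.Coprime.mul_right (Nat.Coprime.pow_right _
      ((hpM i).symm.coprime_dvd_left ((hXM i).mul_left 2)))
      ((hLM i).symm.coprime_dvd_left ((hXM i).mul_left 2))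
  have hcopU : ∀ i, (X i + Y).Coprime (σ i * t + 1) := by
    intro i
    have h1 : ∀ a, a ∣ σ i → a.Coprime (σ i * t + 1) := fun a ha => by
      obtain ⟨b, hb⟩ := ha.mul_right t
      rw [hb]
      simp
    rw [hform i]
    refine Nat.Coprime.mul_left ?_ (Nat.Coprime.mul_left (Nat.Coprime.pow_left _ ?_) ?_)
    · refine h1 _ ((((hXM i).mul_left 2).trans (Dvd.intro (g i) rfl)).trans ?_)
      exact (Dvd.intro _ rfl).trans (Dvd.intro _ rfl)
    · refine h1 _ ((dvd_pow_self _ (Nat.succ_ne_zero (k i))).trans ?_)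
      exact ((Dvd.intro _ rfl).mul_left _).trans (Dvd.intro _ rfl)
    · have h2 : σ i * t + 1 ≡ 1 + 1 [MOD L i] := by
        rw [mul_comm]
        exact (htσ i).add_right 1
      have h3 := h2.gcd_eq
      have h4 : (L i).Coprime 2 := (hLM i).coprime_dvd_right (Dvd.intro _ rfl)
      rw [Nat.coprime_comm, Nat.Coprime, h3]
      exact h4.symm
  have hb₂ := hb₁.shift (Y := P) (u := fun i => σ i * t + 1)
    (fun i => by rw [hPσ i]; ring) hcopU (fun i => Nat.succ_pos _)
  set w₀ : ℚ := q * K * d S * d Λ * d t with hw₀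
  have hd0 : ∀ {a : ℕ}, 0 < a → (0 : ℚ) < d a := fun ha => by exact_mod_cast d_pos ha
  have hkey : ∀ i, (d (σ i * t) : ℚ) * (w i * d (p i ^ m i * L i)) = K * d S * d Λ * d t := by
    intro i
    have e1 : d (σ i * t) = d (M * g i) * (d (p i ^ (k i + 1)) * d (S' i)) * d (Λ' i) * d t := by
      have hMp : ∀ j, M.Coprime (p j) := fun j => (hpM j).symm
      have hMS : (M * g i).Coprime (p i ^ (k i + 1) * S' i) := by
        refine Nat.Coprime.coprime_dvd_right (hkS i) ?_
        refine Nat.Coprime.coprime_dvd_left (hgM i) ?_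
        exact Nat.Coprime.prod_right fun j _ => Nat.Coprime.pow_right _
          (Nat.Coprime.mul_left (hMp j) (hMp j))
      rw [d_mul_of_coprime, hσ]
      · rw [d_mul_of_coprime, d_mul_of_coprime hMS,
          d_mul_of_coprime (Nat.Coprime.pow_left _ (hpS' i))]
        refine Nat.Coprime.coprime_dvd_left (mul_dvd_mul (hgM i) (hkS i)) ?_
        exact Nat.Coprime.prod_right fun j _ => (hLMS j).symm
      · refine Nat.Coprime.symm (Nat.Coprime.mul_right ?_ ?_)
        · exact htMS.coprime_dvd_right (mul_dvd_mul (hgM i) (hkS i))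
        · exact htΛ.coprime_dvd_right (hΛΛ' i ▸ Dvd.intro_left _ rfl)
    have e2 : d S = d (p i ^ e i) * d (S' i) := by
      rw [hSS' i, d_mul_of_coprime (Nat.Coprime.pow_left _ (hpS' i))]
    have e3 : d Λ = d (L i) * d (Λ' i) := by rw [hΛΛ' i, d_mul_of_coprime (hLΛ' i)]
    have e4 : d (p i ^ m i * L i) = d (p i ^ m i) * d (L i) :=
      d_mul_of_coprime (Nat.Coprime.pow_left _ (hLp i i).symm)
    have hm1 : ((k i : ℚ) + 2) = m i * m i := by exact_mod_cast hk i
    rw [e1, e2, e3, e4, d_prime_pow (hp i), d_prime_pow (hp i), d_prime_pow (hp i), hek i,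
      ← (hmK i).2]
    push_cast
    linear_combination ((d (M * g i) : ℚ) * d (S' i) * d (Λ' i) * d t * w i * d (L i)) *
      (1 : ℚ) * hm1
  refine ⟨Fin.cons P fun i => X i + Y + P,
    Fin.cons w₀ fun i => w i * d (p i ^ m i * L i) * d (σ i * t + 1), ?_, ?_, ?_, ?_, ?_⟩
  · exact Fin.cases hP0 fun i => hb₂.pos i
  · rw [Fin.cons_injective_iff]
    refine ⟨?_, hb₂.inj⟩
    rintro ⟨i, hi⟩
    have := h.pos i
    simp only at hi
    omega
  · refine Fin.cases ?_ fun i => hb₂.weight_pos i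
    have := hd0 hS0
    have := hd0 hΛ0
    have := hd0 ht
    simp only [Fin.cons_zero, hw₀]
    positivity
  · refine Fin.cases (Fin.cases ?_ fun j => ?_) fun i => Fin.cases ?_ fun j => ?_
    · simp
    · simp only [Fin.cons_zero, Fin.cons_succ, Nat.add_sub_cancel]
      exact fun _ => ⟨_, hPσ j⟩
    · simp only [Fin.cons_zero, Fin.cons_succ]
      omega
    · exact hb₂.dvd i j
  · refine Fin.cases (Fin.cases ?_ fun j => ?_) fun i => Fin.cases ?_ fun j => ?_
    · simp
    · simp only [Fin.cons_zero, Fin.cons_succ, Nat.add_sub_cancel]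
      intro _
      have hXY : 0 < X j + Y := hb₁.pos j
      have e1 : (X j + Y + P) / (X j + Y) = σ j * t + 1 := by
        rw [hPσ j, add_comm, ← Nat.mul_succ, Nat.mul_div_cancel_left _ hXY]
      have e2 : P / (X j + Y) = σ j * t := by
        nth_rewrite 1 [hPσ j]
        rw [Nat.mul_div_cancel_left _ hXY]
      rw [e1, e2, hw₀]
      linear_combination -(q * d (σ j * t + 1)) * hkey j
    · simp only [Fin.cons_zero, Fin.cons_succ]
      omega
    · exact hb₂.ratio i j

theorem exists_isBalanced {q : ℚ} (hq : 0 < q) (n : ℕ) :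
    ∃ (X : Fin n → ℕ) (w : Fin n → ℚ), IsBalanced q X w := by
  induction n with
  | zero => exact ⟨Fin.elim0, Fin.elim0, fun i => i.elim0, fun i => i.elim0, fun i => i.elim0,
      fun i => i.elim0, fun i => i.elim0⟩
  | succ n ih =>
    obtain ⟨X, w, h⟩ := ih
    exact h.extend hq

/-- `F` is a multilinear polynomial in the variables indexed by `V` whose coefficients, weighted by
`N` to the number of variables, have absolute sum at most `C`. -/
def IsSievePoly (N : ℕ) (F : (ℕ → ℝ) → ℝ) (V : Finset ℕ) (C : ℝ) : Prop :=
  ∃ (κ : Type) (_ : Fintype κ) (c : κ → ℝ) (S : κ → Finset ℕ), (∀ k, S k ⊆ V) ∧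
    (∀ a, F a = ∑ k, c k * ∏ p ∈ S k, a p) ∧ ∑ k, |c k| * (N : ℝ) ^ (S k).card ≤ C

namespace IsSievePoly

variable {N : ℕ} {F G : (ℕ → ℝ) → ℝ} {V W : Finset ℕ} {C D : ℝ}

theorem nonneg (h : IsSievePoly N F V C) : 0 ≤ C := by
  obtain ⟨κ, _, c, S, -, -, hC⟩ := h
  exact (Finset.sum_nonneg fun k _ => by positivity).trans hC

theorem mono (h : IsSievePoly N F V C) (hV : V ⊆ W) (hC : C ≤ D) : IsSievePoly N F W D := by
  obtain ⟨κ, _, c, S, h1, h2, h3⟩ := h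
  exact ⟨κ, inferInstance, c, S, fun k => (h1 k).trans hV, h2, h3.trans hC⟩

theorem monomial (N : ℕ) (S : Finset ℕ) (c : ℝ) :
    IsSievePoly N (fun a => c * ∏ p ∈ S, a p) S (|c| * (N : ℝ) ^ S.card) :=
  ⟨Unit, inferInstance, fun _ => c, fun _ => S, fun _ => subset_rfl, fun a => by simp, by simp⟩

theorem add (hF : IsSievePoly N F V C) (hG : IsSievePoly N G V D) :
    IsSievePoly N (fun a => F a + G a) V (C + D) := by
  obtain ⟨κ, _, c, S, h1, h2, h3⟩ := hF
  obtain ⟨κ', _, c', S', h1', h2', h3'⟩ := hG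
  refine ⟨κ ⊕ κ', inferInstance, Sum.elim c c', Sum.elim S S', ?_, fun a => ?_, ?_⟩
  · rintro (k | k)
    · exact h1 k
    · exact h1' k
  · simp [Fintype.sum_sum_type, h2, h2']
  · simpa [Fintype.sum_sum_type] using add_le_add h3 h3'

theorem mul (hF : IsSievePoly N F V C) (hG : IsSievePoly N G W D) (hVW : Disjoint V W) :
    IsSievePoly N (fun a => F a * G a) (V ∪ W) (C * D) := by
  have hC := hF.nonneg
  obtain ⟨κ, _, c, S, h1, h2, h3⟩ := hF
  obtain ⟨κ', _, c', S', h1', h2', h3'⟩ := hG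
  have hdis : ∀ k k', Disjoint (S k) (S' k') := fun k k' => hVW.mono (h1 k) (h1' k')
  refine ⟨κ × κ', inferInstance, fun k => c k.1 * c' k.2, fun k => S k.1 ∪ S' k.2,
    fun k => Finset.union_subset_union (h1 _) (h1' _), fun a => ?_, ?_⟩
  · simp only [h2, h2', Finset.sum_mul_sum, Fintype.sum_prod_type,
      Finset.prod_union (hdis _ _)]
    exact Finset.sum_congr rfl fun k _ => Finset.sum_congr rfl fun k' _ => by ring
  · calc ∑ k : κ × κ', |c k.1 * c' k.2| * (N : ℝ) ^ (S k.1 ∪ S' k.2).card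
        = (∑ k, |c k| * (N : ℝ) ^ (S k).card) * ∑ k, |c' k| * (N : ℝ) ^ (S' k).card := by
          simp only [Finset.sum_mul_sum, Fintype.sum_prod_type,
            Finset.card_union_of_disjoint (hdis _ _), abs_mul, pow_add]
          exact Finset.sum_congr rfl fun k _ => Finset.sum_congr rfl fun k' _ => by ring
      _ ≤ C * D := mul_le_mul h3 h3' (Finset.sum_nonneg fun k _ => by positivity) hC

theorem const_mul (hF : IsSievePoly N F V C) (r : ℝ) :
    IsSievePoly N (fun a => r * F a) V (|r| * C) := by
  have h := (monomial N ∅ r).mul hF (Finset.disjoint_empty_left _)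
  simpa using h

theorem sum {β : Type*} (s : Finset β) {F : β → (ℕ → ℝ) → ℝ} {C : β → ℝ}
    (h : ∀ b ∈ s, IsSievePoly N (F b) V (C b)) :
    IsSievePoly N (fun a => ∑ b ∈ s, F b a) V (∑ b ∈ s, C b) := by
  classical
  induction s using Finset.induction_on with
  | empty =>
    have := (monomial N ∅ 0).mono (Finset.empty_subset V) (D := 0) (by simp)
    simpa using this
  | insert b s hb ih =>
    have := (h b (Finset.mem_insert_self _ _)).add
      (ih fun b' hb' => h b' (Finset.mem_insert_of_mem hb'))
    simpa [Finset.sum_insert hb] using this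

theorem prod {β : Type*} [DecidableEq β] (s : Finset β) {F : β → (ℕ → ℝ) → ℝ}
    {V : β → Finset ℕ} {C : β → ℝ} (h : ∀ b ∈ s, IsSievePoly N (F b) (V b) (C b))
    (hV : ∀ b ∈ s, ∀ b' ∈ s, b ≠ b' → Disjoint (V b) (V b')) :
    IsSievePoly N (fun a => ∏ b ∈ s, F b a) (s.biUnion V) (∏ b ∈ s, C b) := by
  induction s using Finset.induction_on with
  | empty => simpa using monomial N ∅ 1
  | insert b s hb ih =>
    have h1 := (h b (Finset.mem_insert_self _ _)).mul
      (ih (fun b' hb' => h b' (Finset.mem_insert_of_mem hb')) fun b₁ h₁ b₂ h₂ =>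
        hV b₁ (Finset.mem_insert_of_mem h₁) b₂ (Finset.mem_insert_of_mem h₂)) <| by
        rw [Finset.disjoint_biUnion_right]
        intro b' hb'
        refine hV b (Finset.mem_insert_self _ _) b' (Finset.mem_insert_of_mem hb') ?_
        rintro rfl
        exact hb hb'
    simpa [Finset.prod_insert hb, Finset.biUnion_insert] using h1

end IsSievePoly

/-- The elementary symmetric function of degree `k` of the values of `a` on `P`. -/
def elemSymm (P : Finset ℕ) (k : ℕ) (a : ℕ → ℝ) : ℝ :=
  ∑ S ∈ P.powersetCard k, ∏ p ∈ S, a p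

/-- The inclusion-exclusion sum for `∏ p ∈ P, (1 - a p)` truncated after degree `m`. -/
def truncSieve (P : Finset ℕ) (m : ℕ) (a : ℕ → ℝ) : ℝ :=
  ∑ k ∈ Finset.range (m + 1), (-1) ^ k * elemSymm P k a

theorem elemSymm_zero (P : Finset ℕ) (a : ℕ → ℝ) : elemSymm P 0 a = 1 := by
  simp [elemSymm]

theorem elemSymm_insert {P : Finset ℕ} {p : ℕ} (hp : p ∉ P) (k : ℕ) (a : ℕ → ℝ) :
    elemSymm (insert p P) (k + 1) a = elemSymm P (k + 1) a + a p * elemSymm P k a := by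
  have hmem : ∀ S ∈ P.powersetCard k, p ∉ S := fun S hS hpS =>
    hp ((Finset.mem_powersetCard.1 hS).1 hpS)
  unfold elemSymm
  rw [Finset.powersetCard_succ_insert hp, Finset.sum_union, Finset.sum_image, Finset.mul_sum]
  · congr 1
    exact Finset.sum_congr rfl fun S hS => Finset.prod_insert (hmem S hS)
  · intro S hS T hT hST
    rw [← Finset.erase_insert (hmem S hS), ← Finset.erase_insert (hmem T hT)]
    exact congrArg (fun U => Finset.erase U p) hST
  · rw [Finset.disjoint_left]
    intro S hS hS'
    obtain ⟨T, -, rfl⟩ := Finset.mem_image.1 hS'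
    exact hp ((Finset.mem_powersetCard.1 hS).1 (Finset.mem_insert_self _ _))

theorem truncSieve_insert {P : Finset ℕ} {p : ℕ} (hp : p ∉ P) (m : ℕ) (a : ℕ → ℝ) :
    truncSieve (insert p P) (m + 1) a = truncSieve P (m + 1) a - a p * truncSieve P m a := by
  unfold truncSieve
  rw [Finset.sum_range_succ' _ (m + 1), Finset.sum_range_succ' _ (m + 1), Finset.mul_sum]
  simp only [elemSymm_insert hp, elemSymm_zero, pow_succ, mul_add, Finset.sum_add_distrib]
  have : ∑ k ∈ Finset.range (m + 1), (-1 : ℝ) ^ k * -1 * (a p * elemSymm P k a)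
      = - ∑ k ∈ Finset.range (m + 1), a p * ((-1) ^ k * elemSymm P k a) := by
    rw [← Finset.sum_neg_distrib]
    exact Finset.sum_congr rfl fun k _ => by ring
  rw [this]
  ring

/-- The Bonferroni inequalities. -/
theorem bonferroni (P : Finset ℕ) {a : ℕ → ℝ} (h0 : ∀ p ∈ P, 0 ≤ a p) (h1 : ∀ p ∈ P, a p ≤ 1)
    (m : ℕ) : 0 ≤ (-1) ^ m * (truncSieve P m a - ∏ p ∈ P, (1 - a p)) := by
  induction P using Finset.induction_on generalizing m with
  | empty =>
    have : truncSieve ∅ m a = 1 := by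
      unfold truncSieve
      rw [Finset.sum_range_succ']
      have : ∀ k, elemSymm ∅ (k + 1) a = 0 := fun k => by
        rw [elemSymm, Finset.powersetCard_eq_empty.2 (by simp), Finset.sum_empty]
      simp [this, elemSymm_zero]
    simp [this]
  | insert p P hp ih =>
    have hP0 : ∀ q ∈ P, 0 ≤ a q := fun q hq => h0 q (Finset.mem_insert_of_mem hq)
    have hP1 : ∀ q ∈ P, a q ≤ 1 := fun q hq => h1 q (Finset.mem_insert_of_mem hq)
    have hp0 := h0 p (Finset.mem_insert_self _ _)
    have hp1 := h1 p (Finset.mem_insert_self _ _)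
    rw [Finset.prod_insert hp]
    cases m with
    | zero =>
      have h2 := ih hP0 hP1 0
      have : ∀ P, truncSieve P 0 a = 1 := fun P => by simp [truncSieve, elemSymm_zero]
      rw [this] at h2 ⊢
      have hprod : 0 ≤ ∏ q ∈ P, (1 - a q) :=
        Finset.prod_nonneg fun q hq => sub_nonneg.2 (hP1 q hq)
      simp only [pow_zero, one_mul] at h2 ⊢
      nlinarith
    | succ m =>
      have h2 := ih hP0 hP1 (m + 1)
      have h3 := mul_nonneg hp0 (ih hP0 hP1 m)
      rw [truncSieve_insert hp]
      rw [pow_succ] at h2 ⊢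
      linarith

theorem truncSieve_succ (P : Finset ℕ) (m : ℕ) (a : ℕ → ℝ) :
    truncSieve P (m + 1) a = truncSieve P m a + (-1) ^ (m + 1) * elemSymm P (m + 1) a := by
  unfold truncSieve
  rw [Finset.sum_range_succ]

theorem prod_le_truncSieve (P : Finset ℕ) {a : ℕ → ℝ} (h0 : ∀ p ∈ P, 0 ≤ a p)
    (h1 : ∀ p ∈ P, a p ≤ 1) {m : ℕ} (hm : Even m) :
    ∏ p ∈ P, (1 - a p) ≤ truncSieve P m a := by
  have := bonferroni P h0 h1 m
  rw [hm.neg_one_pow, one_mul] at this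
  linarith

theorem truncSieve_sub_prod_le (P : Finset ℕ) {a : ℕ → ℝ} (h0 : ∀ p ∈ P, 0 ≤ a p)
    (h1 : ∀ p ∈ P, a p ≤ 1) {m : ℕ} (hm : Even m) :
    truncSieve P m a - ∏ p ∈ P, (1 - a p) ≤ elemSymm P (m + 1) a := by
  have := bonferroni P h0 h1 (m + 1)
  rw [truncSieve_succ, hm.add_one.neg_one_pow] at this
  linarith

theorem two_pow_mul_elemSymm_le (P : Finset ℕ) {a : ℕ → ℝ} (h0 : ∀ p ∈ P, 0 ≤ a p) (m : ℕ) :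
    2 ^ m * elemSymm P m a ≤ ∏ p ∈ P, (1 + 2 * a p) := by
  rw [Finset.prod_one_add, elemSymm, Finset.mul_sum]
  calc ∑ S ∈ P.powersetCard m, (2 : ℝ) ^ m * ∏ p ∈ S, a p
      = ∑ S ∈ P.powersetCard m, ∏ p ∈ S, (2 * a p) := by
        refine Finset.sum_congr rfl fun S hS => ?_
        rw [Finset.prod_mul_distrib, Finset.prod_const, (Finset.mem_powersetCard.1 hS).2]
    _ ≤ ∑ S ∈ P.powerset, ∏ p ∈ S, (2 * a p) := by
        refine Finset.sum_le_sum_of_subset_of_nonneg ?_ fun S hS _ => ?_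
        · exact fun S hS => Finset.mem_powerset.2 (Finset.mem_powersetCard.1 hS).1
        · exact Finset.prod_nonneg fun p hp =>
            mul_nonneg two_pos.le (h0 p (Finset.mem_powerset.1 hS hp))

theorem isSievePoly_elemSymm' (N : ℕ) (P : Finset ℕ) (m : ℕ) :
    IsSievePoly N (elemSymm P m) P (((P.card * N : ℕ) : ℝ) ^ m) := by
  have h := IsSievePoly.sum (N := N) (V := P) (P.powersetCard m)
    (F := fun S a => 1 * ∏ p ∈ S, a p) (C := fun _ => (N : ℝ) ^ m) fun S hS => by
      obtain ⟨h1, h2⟩ := Finset.mem_powersetCard.1 hS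
      exact (IsSievePoly.monomial N S 1).mono h1 (by simp [h2])
  simp only [one_mul] at h
  refine h.mono subset_rfl ?_
  rw [Finset.sum_const, Finset.card_powersetCard, nsmul_eq_mul, Nat.cast_mul, mul_pow]
  gcongr
  exact_mod_cast Nat.choose_le_pow _ _

theorem isSievePoly_elemSymm (N : ℕ) (P : Finset ℕ) (m : ℕ) :
    IsSievePoly N (elemSymm P m) P ((1 + (P.card * N : ℕ) : ℝ) ^ m) :=
  (isSievePoly_elemSymm' N P m).mono subset_rfl <| by
    gcongr
    linarith

theorem isSievePoly_truncSieve (N : ℕ) (P : Finset ℕ) (m : ℕ) :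
    IsSievePoly N (truncSieve P m) P ((1 + (P.card * N : ℕ) : ℝ) ^ (m + 1)) := by
  have h := IsSievePoly.sum (N := N) (V := P) (Finset.range (m + 1)) fun k _ =>
    (isSievePoly_elemSymm' N P k).const_mul ((-1) ^ k)
  refine h.mono subset_rfl ?_
  rw [add_comm (1 : ℝ), add_pow]
  calc _ ≤ ∑ k ∈ Finset.range (m + 1), ((P.card * N : ℕ) : ℝ) ^ k * 1 ^ (m + 1 - k) *
        ((m + 1).choose k : ℝ) := by
        refine Finset.sum_le_sum fun k hk => ?_
        have : 1 ≤ (m + 1).choose k :=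
          Nat.choose_pos (by have := Finset.mem_range.1 hk; omega)
        have h1 : (1 : ℝ) ≤ ((m + 1).choose k : ℝ) := by exact_mod_cast this
        simp only [abs_pow, abs_neg, abs_one, one_pow, one_mul, mul_one]
        exact le_mul_of_one_le_right (by positivity) h1
    _ ≤ _ := Finset.sum_le_sum_of_subset_of_nonneg
        (Finset.range_mono (Nat.le_succ _)) fun k _ _ => by positivity

/-- The Brun–Hooley inequality. -/
theorem brunHooley {β : Type*} [DecidableEq β] (s : Finset β) {x y e : β → ℝ}
    (hx : ∀ b ∈ s, 0 ≤ x b) (hxy : ∀ b ∈ s, x b ≤ y b) (hye : ∀ b ∈ s, y b - x b ≤ e b) :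
    ∏ b ∈ s, y b - ∑ l ∈ s, ∏ b ∈ s, (if b = l then e b else y b) ≤ ∏ b ∈ s, x b := by
  induction s using Finset.induction_on with
  | empty => simp
  | insert b s hb ih =>
    have ih' := ih (fun c hc => hx c (Finset.mem_insert_of_mem hc))
      (fun c hc => hxy c (Finset.mem_insert_of_mem hc))
      (fun c hc => hye c (Finset.mem_insert_of_mem hc))
    have hb0 := hx b (Finset.mem_insert_self _ _)
    have hb1 := hxy b (Finset.mem_insert_self _ _)
    have hb2 := hye b (Finset.mem_insert_self _ _)
    have hprod : ∏ c ∈ s, x c ≤ ∏ c ∈ s, y c := Finset.prod_le_prod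
      (fun c hc => hx c (Finset.mem_insert_of_mem hc))
      fun c hc => hxy c (Finset.mem_insert_of_mem hc)
    have hprod0 : 0 ≤ ∏ c ∈ s, x c :=
      Finset.prod_nonneg fun c hc => hx c (Finset.mem_insert_of_mem hc)
    have h1 : ∏ c ∈ s, (if c = b then e c else y c) = ∏ c ∈ s, y c :=
      Finset.prod_congr rfl fun c hc => if_neg fun h : c = b => hb (h ▸ hc)
    have h2 : ∑ l ∈ s, ∏ c ∈ insert b s, (if c = l then e c else y c)
        = y b * ∑ l ∈ s, ∏ c ∈ s, (if c = l then e c else y c) := by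
      rw [Finset.mul_sum]
      refine Finset.sum_congr rfl fun l hl => ?_
      rw [Finset.prod_insert hb, if_neg fun h : b = l => hb (h ▸ hl)]
    rw [Finset.sum_insert hb, h2, Finset.prod_insert hb, Finset.prod_insert hb,
      Finset.prod_insert hb, if_pos rfl, h1]
    nlinarith [mul_le_mul_of_nonneg_left ih' (hb0.trans hb1),
      mul_nonneg (sub_nonneg.2 hb2) (hprod0.trans hprod),
      mul_nonneg (sub_nonneg.2 hb1) (sub_nonneg.2 hprod)]

/-- The number of indices `i` for which `p` divides the value of the form `A i * t + B i`. -/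
def divCount {N : ℕ} (A B : Fin N → ℕ) (t p : ℕ) : ℝ :=
  ∑ i, if p ∣ A i * t + B i then 1 else 0

theorem abs_count_modEq_sub_le {M : ℕ} (hM : 0 < M) (c X : ℕ) :
    |(∑ t ∈ Finset.range X, if t ≡ c [MOD M] then (1 : ℝ) else 0) - X / M| ≤ 1 := by
  have h1 : (∑ t ∈ Finset.range X, if t ≡ c [MOD M] then (1 : ℝ) else 0)
      = (X.count (· ≡ c [MOD M]) : ℝ) := by
    rw [Finset.sum_boole, Nat.count_eq_card_filter_range]
  have h2 := Nat.count_modEq_card_eq_ceil X hM c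
  rw [h1]
  have hM' : (0 : ℝ) < M := by exact_mod_cast hM
  have h3 : ((c % M : ℕ) : ℝ) < M := by exact_mod_cast Nat.mod_lt c hM
  have h4 : (((X : ℚ) - (c % M : ℕ)) / M : ℚ) ≤ (X.count (· ≡ c [MOD M]) : ℚ) := by
    have := Int.le_ceil (((X : ℚ) - (c % M : ℕ)) / M : ℚ)
    rw [← h2] at this
    exact_mod_cast this
  have h5 : (X.count (· ≡ c [MOD M]) : ℚ) < (((X : ℚ) - (c % M : ℕ)) / M : ℚ) + 1 := by
    have := Int.ceil_lt_add_one (((X : ℚ) - (c % M : ℕ)) / M : ℚ)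
    rw [← h2] at this
    exact_mod_cast this
  have h4' : (((X : ℝ) - (c % M : ℕ)) / M : ℝ) ≤ (X.count (· ≡ c [MOD M]) : ℝ) := by
    exact_mod_cast h4
  have h5' : (X.count (· ≡ c [MOD M]) : ℝ) < (((X : ℝ) - (c % M : ℕ)) / M : ℝ) + 1 := by
    exact_mod_cast h5
  rw [sub_div] at h4' h5'
  have h6 : ((c % M : ℕ) : ℝ) / M ≤ 1 := (div_le_one hM').2 h3.le
  have h7 : 0 ≤ ((c % M : ℕ) : ℝ) / M := by positivity
  rw [abs_le]
  constructor <;> linarith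

theorem exists_root_modEq {m a : ℕ} (hm : m ≠ 0) (ha : a.Coprime m) (b : ℕ) :
    ∃ c, ∀ t, m ∣ a * t + b ↔ t ≡ c [MOD m] := by
  have : NeZero m := ⟨hm⟩
  have ha' := ZMod.coe_mul_inv_eq_one a ha
  refine ⟨(-(b : ZMod m) * (a : ZMod m)⁻¹).val, fun t => ?_⟩
  rw [← ZMod.natCast_eq_natCast_iff, ZMod.natCast_val, ZMod.cast_id,
    ← ZMod.natCast_eq_zero_iff, Nat.cast_add, Nat.cast_mul]
  constructor
  · intro h
    linear_combination (a : ZMod m)⁻¹ * h - t * ha'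
  · intro h
    linear_combination (a : ZMod m) * h - b * ha'

theorem abs_sum_prod_divCount_sub_le {N : ℕ} (A B : Fin N → ℕ) (X : ℕ) (S : Finset ℕ)
    (hp : ∀ p ∈ S, p.Prime) (hA : ∀ p ∈ S, ∀ i, ¬ p ∣ A i) {M : ℕ} (hM : 0 < M)
    (hMS : ∀ p ∈ S, M.Coprime p) (c : ℕ) :
    |(∑ t ∈ Finset.range X, (if t ≡ c [MOD M] then (1 : ℝ) else 0) * ∏ p ∈ S, divCount A B t p)
      - X / M * ∏ p ∈ S, (N / p : ℝ)| ≤ (N : ℝ) ^ S.card := by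
  induction S using Finset.induction_on generalizing M c with
  | empty => simpa using abs_count_modEq_sub_le hM c X
  | insert p S hpS ih =>
    have hpp := hp p (Finset.mem_insert_self _ _)
    have hMp := hMS p (Finset.mem_insert_self _ _)
    have hsub : ∀ {q}, q ∈ S → q ∈ insert p S := fun h => Finset.mem_insert_of_mem h
    choose r hr using fun i => exists_root_modEq hpp.ne_zero
      ((hpp.coprime_iff_not_dvd.2 (hA p (Finset.mem_insert_self _ _) i)).symm) (B i)
    have hcop : ∀ q ∈ S, (M * p).Coprime q := fun q hq =>
      (hMS q (hsub hq)).mul_left <| (Nat.coprime_primes hpp (hp q (hsub hq))).2 <| by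
        rintro rfl
        exact hpS hq
    have key := fun i => ih (fun q hq => hp q (hsub hq)) (fun q hq => hA q (hsub hq))
      (Nat.mul_pos hM hpp.pos) hcop (Nat.chineseRemainder hMp c (r i))
    have hind : ∀ t i, (if t ≡ Nat.chineseRemainder hMp c (r i) [MOD M * p] then (1 : ℝ) else 0)
        = (if t ≡ c [MOD M] then 1 else 0) * if p ∣ A i * t + B i then 1 else 0 := by
      intro t i
      rw [ite_zero_mul_ite_zero, mul_one]
      refine if_congr ?_ rfl rfl
      rw [← Nat.modEq_and_modEq_iff_modEq_mul hMp, hr]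
      have h1 := (Nat.chineseRemainder hMp c (r i)).2.1
      have h2 := (Nat.chineseRemainder hMp c (r i)).2.2
      exact ⟨fun h => ⟨h.1.trans h1, h.2.trans h2⟩, fun h => ⟨h.1.trans h1.symm, h.2.trans h2.symm⟩⟩
    have hsum : (∑ t ∈ Finset.range X, (if t ≡ c [MOD M] then (1 : ℝ) else 0) *
          ∏ q ∈ insert p S, divCount A B t q) - X / M * ∏ q ∈ insert p S, (N / q : ℝ)
        = ∑ i : Fin N, ((∑ t ∈ Finset.range X,
          (if t ≡ Nat.chineseRemainder hMp c (r i) [MOD M * p] then (1 : ℝ) else 0) *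
            ∏ q ∈ S, divCount A B t q) - X / (M * p : ℕ) * ∏ q ∈ S, (N / q : ℝ)) := by
      rw [Finset.sum_sub_distrib, Finset.sum_comm]
      congr 1
      · refine Finset.sum_congr rfl fun t _ => ?_
        simp only [hind]
        rw [Finset.prod_insert hpS, ← Finset.sum_mul, ← Finset.mul_sum, ← mul_assoc]
        rfl
      · rw [Finset.prod_insert hpS, Finset.sum_const, Finset.card_univ, Fintype.card_fin,
          nsmul_eq_mul, Nat.cast_mul]
        have : (p : ℝ) ≠ 0 := by exact_mod_cast hpp.ne_zero
        have : (M : ℝ) ≠ 0 := by exact_mod_cast hM.ne'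
        field_simp
    rw [hsum, Finset.card_insert_of_notMem hpS, pow_succ']
    refine (Finset.abs_sum_le_sum_abs _ _).trans ((Finset.sum_le_sum fun i _ => key i).trans ?_)
    simp

theorem IsSievePoly.abs_sum_divCount_sub_le {N : ℕ} {F : (ℕ → ℝ) → ℝ} {V : Finset ℕ} {C : ℝ}
    (h : IsSievePoly N F V C) (A B : Fin N → ℕ) (X : ℕ) (hp : ∀ p ∈ V, p.Prime)
    (hA : ∀ p ∈ V, ∀ i, ¬ p ∣ A i) :
    |(∑ t ∈ Finset.range X, F (divCount A B t)) - X * F (fun p => N / p)| ≤ C := by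
  obtain ⟨κ, _, c, S, h1, h2, h3⟩ := h
  have key : ∀ k, |(∑ t ∈ Finset.range X, ∏ p ∈ S k, divCount A B t p)
      - X * ∏ p ∈ S k, (N / p : ℝ)| ≤ (N : ℝ) ^ (S k).card := fun k => by
    simpa [Nat.modEq_one] using abs_sum_prod_divCount_sub_le A B X (S k)
      (fun p hpS => hp p (h1 k hpS)) (fun p hpS => hA p (h1 k hpS)) one_pos
      (fun p _ => Nat.coprime_one_left p) 0
  have hsum : (∑ t ∈ Finset.range X, F (divCount A B t)) - X * F (fun p => N / p)
      = ∑ k, c k * ((∑ t ∈ Finset.range X, ∏ p ∈ S k, divCount A B t p)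
      - X * ∏ p ∈ S k, (N / p : ℝ)) := by
    simp only [h2, mul_sub, Finset.sum_sub_distrib, Finset.mul_sum]
    rw [Finset.sum_comm]
    congr 1
    exact Finset.sum_congr rfl fun k _ => by ring
  rw [hsum]
  refine (Finset.abs_sum_le_sum_abs _ _).trans ((Finset.sum_le_sum fun k _ => ?_).trans h3)
  rw [abs_mul]
  exact mul_le_mul_of_nonneg_left (key k) (abs_nonneg _)

theorem sum_inv_primes_dyadic_le {j : ℕ} (hj : 0 < j) :
    ∑ p ∈ Finset.Ioc (2 ^ j : ℕ) (2 ^ (j + 1)) with Nat.Prime p, (1 / (p : ℕ) : ℝ) ≤ 4 / j := by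
  set P := {p ∈ Finset.Ioc (2 ^ j) (2 ^ (j + 1)) | p.Prime} with hP
  have hmem : ∀ p ∈ P, 2 ^ j < p ∧ p ≤ 2 ^ (j + 1) ∧ p.Prime := fun p hp => by
    obtain ⟨h1, h2⟩ := Finset.mem_filter.1 hp
    exact ⟨(Finset.mem_Ioc.1 h1).1, (Finset.mem_Ioc.1 h1).2, h2⟩
  have h1 : ∏ p ∈ P, p ≤ 4 ^ 2 ^ (j + 1) := by
    refine le_trans ?_ (primorial_le_four_pow _)
    refine Finset.prod_le_prod_of_subset_of_one_le' (fun p hp => ?_) fun p hp _ => ?_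
    · exact Finset.mem_filter.2 ⟨Finset.mem_range.2 (Nat.lt_succ_of_le (hmem p hp).2.1),
        (hmem p hp).2.2⟩
    · exact (Finset.mem_filter.1 hp).2.one_lt.le
  have h2 : (2 ^ j) ^ P.card ≤ ∏ p ∈ P, p := by
    rw [← Finset.prod_const]
    exact Finset.prod_le_prod' fun p hp => (hmem p hp).1.le
  have h3 : j * P.card ≤ 2 ^ (j + 2) := by
    have h4 : (4 : ℕ) ^ 2 ^ (j + 1) = 2 ^ 2 ^ (j + 2) := by
      rw [show (4 : ℕ) = 2 ^ 2 by norm_num, ← pow_mul, ← pow_succ']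
    have := h2.trans h1
    rw [h4, ← pow_mul] at this
    exact (Nat.pow_le_pow_iff_right one_lt_two).1 this
  have h4 : ∑ p ∈ P, (1 / p : ℝ) ≤ P.card * (1 / 2 ^ j) := by
    rw [← nsmul_eq_mul]
    refine Finset.sum_le_card_nsmul _ _ _ fun p hp => ?_
    have : (2 : ℝ) ^ j ≤ p := by exact_mod_cast (hmem p hp).1.le
    exact one_div_le_one_div_of_le (by positivity) this
  refine h4.trans ?_
  have h5 : (j : ℝ) * P.card ≤ 2 ^ (j + 2) := by exact_mod_cast h3
  have hj' : (0 : ℝ) < j := by exact_mod_cast hj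
  rw [mul_one_div, div_le_div_iff₀ (by positivity) hj']
  rw [pow_add] at h5
  linarith

theorem sum_inv_primes_le {K : ℕ} (hK : 0 < K) (n : ℕ) :
    ∑ p ∈ Finset.Ioc (2 ^ K : ℕ) (2 ^ (K + n)) with Nat.Prime p, (1 / (p : ℕ) : ℝ) ≤ 4 * n / K := by
  induction n with
  | zero => simp
  | succ n ih =>
    have hU : Finset.Ioc (2 ^ K) (2 ^ (K + (n + 1)))
        = Finset.Ioc (2 ^ K) (2 ^ (K + n)) ∪ Finset.Ioc (2 ^ (K + n)) (2 ^ (K + n + 1)) :=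
      (Finset.Ioc_union_Ioc_eq_Ioc (Nat.pow_le_pow_right two_pos (Nat.le_add_right _ _))
        (Nat.pow_le_pow_right two_pos (Nat.le_succ _))).symm
    have hdis : Disjoint (Finset.Ioc (2 ^ K) (2 ^ (K + n)))
        (Finset.Ioc (2 ^ (K + n)) (2 ^ (K + n + 1))) := by
      rw [Finset.disjoint_left]
      intro p hp hp'
      exact absurd (Finset.mem_Ioc.1 hp).2 (Finset.mem_Ioc.1 hp').1.not_ge
    rw [hU, Finset.filter_union, Finset.sum_union (hdis.mono (Finset.filter_subset _ _)
      (Finset.filter_subset _ _))]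
    have h1 := sum_inv_primes_dyadic_le (j := K + n) (by omega)
    have h2 : (4 / (K + n : ℕ) : ℝ) ≤ 4 / K := by
      gcongr
      exact Nat.le_add_right _ _
    have h3 : (4 * (n + 1 : ℕ) / K : ℝ) = 4 * n / K + 4 / K := by
      push_cast
      ring
    linarith

theorem elemSymm_succ_model_le {N m : ℕ} {P : Finset ℕ} {y₀ : ℝ}
    (hP : ∀ p ∈ P, 2 * N ≤ p) (hs : ∑ p ∈ P, (N / p : ℝ) ≤ 4 * N) (hm : Even m)
    (hy : y₀ = truncSieve P m fun p => N / p) :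
    Real.exp (-(8 * N)) ≤ y₀ ∧
      elemSymm P (m + 1) (fun p => N / p) ≤ Real.exp (16 * N) / 2 ^ (m + 1) * y₀ := by
  have h0 : ∀ p ∈ P, (0 : ℝ) ≤ N / p := fun p _ => by positivity
  have h2 : ∀ p ∈ P, (N / p : ℝ) ≤ 1 / 2 := fun p hp => by
    have h : (2 * N : ℝ) ≤ p := by exact_mod_cast hP p hp
    rcases (Nat.cast_nonneg p : (0 : ℝ) ≤ p).eq_or_lt with h' | h'
    · rw [← h', div_zero]
      norm_num
    · rw [div_le_div_iff₀ h' two_pos]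
      linarith
  have hE : ∏ p ∈ P, (1 + 2 * (N / p : ℝ)) ≤ Real.exp (8 * N) := by
    calc ∏ p ∈ P, (1 + 2 * (N / p : ℝ)) ≤ ∏ p ∈ P, Real.exp (2 * (N / p : ℝ)) :=
          Finset.prod_le_prod (fun p hp => by linarith [h0 p hp]) fun p _ => by
            rw [add_comm]
            exact Real.add_one_le_exp _
      _ = Real.exp (2 * ∑ p ∈ P, (N / p : ℝ)) := by rw [← Real.exp_sum, Finset.mul_sum]
      _ ≤ _ := Real.exp_le_exp.2 (by linarith)
  have hprod : 1 ≤ (∏ p ∈ P, (1 - (N / p : ℝ))) * ∏ p ∈ P, (1 + 2 * (N / p : ℝ)) := by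
    rw [← Finset.prod_mul_distrib]
    calc (1 : ℝ) = ∏ p ∈ P, 1 := Finset.prod_const_one.symm
      _ ≤ _ := Finset.prod_le_prod (fun _ _ => zero_le_one) fun p hp => by
        nlinarith [h0 p hp, h2 p hp]
  have hpos : 0 ≤ ∏ p ∈ P, (1 - (N / p : ℝ)) :=
    Finset.prod_nonneg fun p hp => by linarith [h2 p hp]
  have hy1 := prod_le_truncSieve P h0 (fun p hp => by linarith [h2 p hp]) hm
  rw [← hy] at hy1
  have hy2 : Real.exp (-(8 * N)) ≤ y₀ := by
    rw [Real.exp_neg, inv_le_iff_one_le_mul₀ (Real.exp_pos _)]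
    exact hprod.trans (mul_le_mul hy1 hE (Finset.prod_nonneg fun p hp => by linarith [h0 p hp])
      (hpos.trans hy1))
  refine ⟨hy2, ?_⟩
  have h3 := (two_pow_mul_elemSymm_le P h0 (m + 1)).trans hE
  have h4 : Real.exp (8 * N) ≤ Real.exp (16 * N) * y₀ := by
    have : Real.exp (8 * N) = Real.exp (16 * N) * Real.exp (-(8 * N)) := by
      rw [← Real.exp_add]
      congr 1
      ring
    rw [this]
    gcongr
  rw [div_mul_eq_mul_div, le_div_iff₀ (by positivity), mul_comm]
  exact h3.trans h4

theorem prod_ite_eq_le {β : Type*} [DecidableEq β] {s : Finset β} {l : β} (hl : l ∈ s)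
    {y e : β → ℝ} {c : ℝ} (hy : ∀ b ∈ s, 0 ≤ y b) (he : e l ≤ c * y l) :
    ∏ b ∈ s, (if b = l then e b else y b) ≤ c * ∏ b ∈ s, y b := by
  rw [← Finset.mul_prod_erase s _ hl, ← Finset.mul_prod_erase s y hl, if_pos rfl, ← mul_assoc]
  have : ∏ b ∈ s.erase l, (if b = l then e b else y b) = ∏ b ∈ s.erase l, y b :=
    Finset.prod_congr rfl fun b hb => if_neg (Finset.ne_of_mem_erase hb)
  rw [this]
  exact mul_le_mul_of_nonneg_right he
    (Finset.prod_nonneg fun b hb => hy b (Finset.mem_of_mem_erase hb))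

/-- The even truncation level used on the `j`-th of `r` blocks of primes. -/
def truncLevel (N r j : ℕ) : ℕ := 24 * N + 2 + 2 * (r - 1 - j)

/-- A lower bound for the indicator function of "`a` vanishes on `P 0`, …, `P (r - 1)` and its sum
over `M` is less than `H`". -/
noncomputable def sieveMinorant (N : ℕ) (P : ℕ → Finset ℕ) (r : ℕ) (M : Finset ℕ) (H : ℝ)
    (a : ℕ → ℝ) : ℝ :=
  ∏ j ∈ Finset.range r, truncSieve (P j) (truncLevel N r j) a
    - ∑ l ∈ Finset.range r, ∏ j ∈ Finset.range r, (if j = l then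
      elemSymm (P j) (truncLevel N r j + 1) a else truncSieve (P j) (truncLevel N r j) a)
    - 1 / H * (∑ p ∈ M, a p) * ∏ j ∈ Finset.range r, truncSieve (P j) (truncLevel N r j) a

theorem even_truncLevel (N r j : ℕ) : Even (truncLevel N r j) :=
  ⟨12 * N + 1 + (r - 1 - j), by unfold truncLevel; ring⟩

theorem sieveMinorant_le_prod {N : ℕ} {P : ℕ → Finset ℕ} {r : ℕ} {M : Finset ℕ} {H : ℝ}
    {a : ℕ → ℝ} (h0 : ∀ p, 0 ≤ a p) (h1 : ∀ j < r, ∀ p ∈ P j, a p ≤ 1) (hH : 0 < H) :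
    sieveMinorant N P r M H a ≤
      (1 - (∑ p ∈ M, a p) / H) * ∏ j ∈ Finset.range r, ∏ p ∈ P j, (1 - a p) := by
  have hx : ∀ j ∈ Finset.range r, 0 ≤ ∏ p ∈ P j, (1 - a p) := fun j hj =>
    Finset.prod_nonneg fun p hp => sub_nonneg.2 (h1 j (Finset.mem_range.1 hj) p hp)
  have hxy : ∀ j ∈ Finset.range r,
      ∏ p ∈ P j, (1 - a p) ≤ truncSieve (P j) (truncLevel N r j) a := fun j hj =>
    prod_le_truncSieve _ (fun p _ => h0 p) (h1 j (Finset.mem_range.1 hj)) (even_truncLevel _ _ _)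
  have hBH := brunHooley (Finset.range r) hx hxy fun j hj =>
    truncSieve_sub_prod_le _ (fun p _ => h0 p) (h1 j (Finset.mem_range.1 hj))
      (even_truncLevel N r j)
  have hprod := Finset.prod_le_prod hx hxy
  have hM : 0 ≤ 1 / H * ∑ p ∈ M, a p :=
    mul_nonneg (by positivity) (Finset.sum_nonneg fun p _ => h0 p)
  have h3 := mul_le_mul_of_nonneg_left hprod hM
  unfold sieveMinorant
  calc _ ≤ ∏ j ∈ Finset.range r, ∏ p ∈ P j, (1 - a p)
        - 1 / H * (∑ p ∈ M, a p) * ∏ j ∈ Finset.range r, ∏ p ∈ P j, (1 - a p) := by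
        linarith
    _ = _ := by ring

theorem sieveMinorant_le_one {N : ℕ} {P : ℕ → Finset ℕ} {r : ℕ} {M : Finset ℕ} {H : ℝ}
    {a : ℕ → ℝ} (h0 : ∀ p, 0 ≤ a p) (h1 : ∀ j < r, ∀ p ∈ P j, a p ≤ 1) (hH : 0 < H) :
    sieveMinorant N P r M H a ≤ 1 := by
  have hx : ∀ j ∈ Finset.range r, 0 ≤ ∏ p ∈ P j, (1 - a p) := fun j hj =>
    Finset.prod_nonneg fun p hp => sub_nonneg.2 (h1 j (Finset.mem_range.1 hj) p hp)
  have hx1 : ∏ j ∈ Finset.range r, ∏ p ∈ P j, (1 - a p) ≤ 1 :=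
    Finset.prod_le_one hx fun j hj => Finset.prod_le_one
      (fun p hp => sub_nonneg.2 (h1 j (Finset.mem_range.1 hj) p hp)) fun p _ => by linarith [h0 p]
  have hM : 0 ≤ (∑ p ∈ M, a p) / H := div_nonneg (Finset.sum_nonneg fun p _ => h0 p) hH.le
  have := sieveMinorant_le_prod (N := N) (M := M) h0 h1 hH
  nlinarith [Finset.prod_nonneg hx]

theorem of_sieveMinorant_pos {N : ℕ} {P : ℕ → Finset ℕ} {r : ℕ} {M : Finset ℕ} {H : ℝ}
    {a : ℕ → ℝ} (h01 : ∀ p, 0 ≤ a p) (h1 : ∀ j < r, ∀ p ∈ P j, a p ≤ 1) (hH : 0 < H)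
    (hpos : 0 < sieveMinorant N P r M H a) :
    (∀ j < r, ∀ p ∈ P j, a p < 1) ∧ ∑ p ∈ M, a p < H := by
  have hx : ∀ j ∈ Finset.range r, 0 ≤ ∏ p ∈ P j, (1 - a p) := fun j hj =>
    Finset.prod_nonneg fun p hp => sub_nonneg.2 (h1 j (Finset.mem_range.1 hj) p hp)
  have h := hpos.trans_le (sieveMinorant_le_prod (N := N) (M := M) h01 h1 hH)
  have hne := pos_of_mul_pos_left h (Finset.prod_nonneg hx)
  constructor
  · intro j hj p hp
    refine lt_of_le_of_ne (h1 j hj p hp) fun hap => ?_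
    have : ∏ j ∈ Finset.range r, ∏ p ∈ P j, (1 - a p) = 0 :=
      Finset.prod_eq_zero (Finset.mem_range.2 hj)
        (Finset.prod_eq_zero hp (by rw [hap, sub_self]))
    rw [this, mul_zero] at h
    exact lt_irrefl _ h
  · rwa [sub_pos, div_lt_one hH] at hne

theorem exp_two_mul_le_two_pow (n : ℕ) : Real.exp (2 * n) ≤ 2 ^ (3 * n) := by
  have h : Real.exp 2 ≤ 8 := by
    have := Real.exp_one_lt_d9
    have h3 : Real.exp 2 = Real.exp 1 * Real.exp 1 := by
      rw [← Real.exp_add]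
      norm_num
    rw [h3]
    nlinarith [Real.exp_pos 1]
  calc Real.exp (2 * n) = Real.exp 2 ^ n := by
        rw [← Real.exp_nat_mul, mul_comm]
    _ ≤ 8 ^ n := by gcongr
    _ = 2 ^ (3 * n) := by
        rw [pow_mul]
        norm_num

theorem exp_div_two_pow_truncLevel_le (N r j : ℕ) :
    Real.exp (16 * N) / 2 ^ (truncLevel N r j + 1) ≤ 1 / 8 * (1 / 4) ^ (r - 1 - j) := by
  have h1 : Real.exp (16 * N) ≤ 2 ^ (24 * N) := by
    have := exp_two_mul_le_two_pow (8 * N)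
    rw [← mul_assoc] at this
    refine le_trans (le_of_eq ?_) this
    congr 1
    push_cast
    ring
  rw [div_le_iff₀ (by positivity)]
  refine h1.trans (le_of_eq ?_)
  rw [truncLevel, show 24 * N + 2 + 2 * (r - 1 - j) + 1 = 24 * N + 3 + 2 * (r - 1 - j) by ring,
    pow_add, pow_add, pow_mul 2 2, div_pow, one_pow]
  field_simp
  norm_num

theorem sieveMinorant_model_ge {N : ℕ} {P : ℕ → Finset ℕ} {r : ℕ} {M : Finset ℕ} {H : ℝ}
    (hP : ∀ j < r, ∀ p ∈ P j, 2 * N ≤ p) (hs : ∀ j < r, ∑ p ∈ P j, (N / p : ℝ) ≤ 4 * N)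
    (hH : 0 < H) (hM : ∑ p ∈ M, (N / p : ℝ) ≤ H / 4) :
    Real.exp (-(8 * N)) ^ r / 2 ≤ sieveMinorant N P r M H fun p => N / p := by
  set y : ℕ → ℝ := fun j => truncSieve (P j) (truncLevel N r j) fun p => N / p with hy
  set e : ℕ → ℝ := fun j => elemSymm (P j) (truncLevel N r j + 1) fun p => N / p with he
  have hblock := fun j (hj : j < r) => elemSymm_succ_model_le (hP j hj) (hs j hj)
    (even_truncLevel N r j) (rfl : y j = _)
  have hy0 : ∀ j ∈ Finset.range r, 0 ≤ y j := fun j hj =>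
    (Real.exp_pos _).le.trans (hblock j (Finset.mem_range.1 hj)).1
  have hY : Real.exp (-(8 * N)) ^ r ≤ ∏ j ∈ Finset.range r, y j := by
    conv_lhs => rw [← Finset.card_range r, ← Finset.prod_const]
    exact Finset.prod_le_prod (fun _ _ => (Real.exp_pos _).le) fun j hj =>
      (hblock j (Finset.mem_range.1 hj)).1
  have hY0 := (pow_pos (Real.exp_pos (-(8 * N : ℝ))) r).le.trans hY
  have hsum : ∑ l ∈ Finset.range r, ∏ j ∈ Finset.range r, (if j = l then e j else y j)
      ≤ 1 / 4 * ∏ j ∈ Finset.range r, y j := by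
    calc ∑ l ∈ Finset.range r, ∏ j ∈ Finset.range r, (if j = l then e j else y j)
        ≤ ∑ l ∈ Finset.range r, 1 / 8 * (1 / 4) ^ (r - 1 - l) * ∏ j ∈ Finset.range r, y j :=
          Finset.sum_le_sum fun l hl => prod_ite_eq_le hl hy0 <|
            (hblock l (Finset.mem_range.1 hl)).2.trans <| mul_le_mul_of_nonneg_right
              (exp_div_two_pow_truncLevel_le N r l) (hy0 l hl)
      _ = 1 / 8 * (∑ l ∈ Finset.range r, (1 / 4 : ℝ) ^ l) * ∏ j ∈ Finset.range r, y j := by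
          rw [← Finset.sum_mul, ← Finset.mul_sum,
            Finset.sum_range_reflect (fun l => (1 / 4 : ℝ) ^ l) r]
      _ ≤ _ := by
          gcongr
          rw [geom_sum_eq (by norm_num)]
          have : (0 : ℝ) < (1 / 4) ^ r := by positivity
          rw [show (1 / 4 - 1 : ℝ) = -(3 / 4) by norm_num, div_neg, ← neg_div, neg_sub]
          linarith
  have hMid : 1 / H * (∑ p ∈ M, (N / p : ℝ)) ≤ 1 / 4 := by
    rw [one_div, inv_mul_le_iff₀ hH]
    linarith
  have hMid' := mul_le_mul_of_nonneg_right hMid hY0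
  change _ ≤ ∏ j ∈ Finset.range r, y j
    - ∑ l ∈ Finset.range r, ∏ j ∈ Finset.range r, (if j = l then e j else y j)
    - 1 / H * (∑ p ∈ M, (N / p : ℝ)) * ∏ j ∈ Finset.range r, y j
  linarith

theorem isSievePoly_sieveMinorant {N : ℕ} {P : ℕ → Finset ℕ} {r : ℕ} {M : Finset ℕ} {H D : ℝ}
    (hdis : ∀ i < r, ∀ j < r, i ≠ j → Disjoint (P i) (P j)) (hM : ∀ j < r, Disjoint M (P j))
    (hD : ∏ j ∈ Finset.range r, (1 + ((P j).card * N : ℕ) : ℝ) ^ (truncLevel N r j + 1) ≤ D) :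
    IsSievePoly N (sieveMinorant N P r M H) (M ∪ (Finset.range r).biUnion P)
      (D + r * D + |1 / H| * (M.card * N) * D) := by
  have hdis' : ∀ i ∈ Finset.range r, ∀ j ∈ Finset.range r, i ≠ j → Disjoint (P i) (P j) :=
    fun i hi j hj => hdis i (Finset.mem_range.1 hi) j (Finset.mem_range.1 hj)
  have h1 : IsSievePoly N (fun a => ∏ j ∈ Finset.range r, truncSieve (P j) (truncLevel N r j) a)
      ((Finset.range r).biUnion P) D :=
    (IsSievePoly.prod (Finset.range r) (fun j _ => isSievePoly_truncSieve N (P j) _) hdis').mono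
      subset_rfl hD
  have h2 := fun l => (IsSievePoly.prod (N := N) (Finset.range r) (F := fun j a => if j = l then
      elemSymm (P j) (truncLevel N r j + 1) a else truncSieve (P j) (truncLevel N r j) a)
      (fun j _ => by
        split_ifs
        · exact isSievePoly_elemSymm N (P j) _
        · exact isSievePoly_truncSieve N (P j) _) hdis').mono subset_rfl hD
  have h3 := (IsSievePoly.sum (Finset.range r) fun l _ => h2 l).const_mul (-1)
  have h4 : IsSievePoly N (fun a => ∑ p ∈ M, a p) M (M.card * N) := by
    have := IsSievePoly.sum (N := N) (V := M) M (F := fun p a => 1 * ∏ q ∈ {p}, a q)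
      (C := fun _ => (N : ℝ)) fun p hp =>
        (IsSievePoly.monomial N {p} 1).mono (Finset.singleton_subset_iff.2 hp) (by simp)
    simpa using this
  have h5 := ((h4.const_mul (1 / H)).mul h1 ((Finset.disjoint_biUnion_right _ _ _).2 fun j hj =>
    hM j (Finset.mem_range.1 hj))).const_mul (-1)
  have h6 := ((h1.add h3).mono Finset.subset_union_right le_rfl).add h5
  convert h6 using 1
  · funext a
    unfold sieveMinorant
    ring
  · simp

theorem sum_two_pow_mul_level_add_le (c r : ℕ) :
    (∑ j ∈ Finset.range r, 2 ^ (j + 2) * (c + 2 * (r - 1 - j))) + 4 * c + 8 * r + 8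
      ≤ (8 + 4 * c) * 2 ^ r := by
  induction r with
  | zero => simp; omega
  | succ r ih =>
    have h : ∑ j ∈ Finset.range r, 2 ^ (j + 1 + 2) * (c + 2 * (r + 1 - 1 - (j + 1)))
        = 2 * ∑ j ∈ Finset.range r, 2 ^ (j + 2) * (c + 2 * (r - 1 - j)) := by
      rw [Finset.mul_sum]
      refine Finset.sum_congr rfl fun j _ => ?_
      rw [show r + 1 - 1 - (j + 1) = r - 1 - j by omega]
      ring
    rw [Finset.sum_range_succ', h, pow_succ 2 r]
    simp only [Nat.add_sub_cancel, Nat.sub_zero]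
    norm_num
    nlinarith

/-- The primes in `(2 ^ a, 2 ^ b]` not dividing `Q`. -/
def primesBetween (Q a b : ℕ) : Finset ℕ :=
  {p ∈ Finset.Ioc (2 ^ a) (2 ^ b) | p.Prime ∧ ¬ p ∣ Q}

theorem mem_primesBetween {Q a b p : ℕ} :
    p ∈ primesBetween Q a b ↔ 2 ^ a < p ∧ p ≤ 2 ^ b ∧ p.Prime ∧ ¬ p ∣ Q := by
  rw [primesBetween, Finset.mem_filter, Finset.mem_Ioc, and_assoc]

theorem card_primesBetween_lt (Q a b : ℕ) : (primesBetween Q a b).card < 2 ^ b := by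
  refine (Finset.card_filter_le _ _).trans_lt ?_
  rw [Nat.card_Ioc]
  exact Nat.sub_lt (by positivity) (by positivity)

theorem disjoint_primesBetween (Q : ℕ) {a b a' b' : ℕ} (h : b ≤ a') :
    Disjoint (primesBetween Q a b) (primesBetween Q a' b') := by
  rw [Finset.disjoint_left]
  intro p hp hp'
  exact absurd ((mem_primesBetween.1 hp).2.1.trans (Nat.pow_le_pow_right two_pos h))
    (mem_primesBetween.1 hp').1.not_ge

theorem sum_primesBetween_le (N Q : ℕ) {K : ℕ} (hK : 0 < K) :
    ∑ p ∈ primesBetween Q K (K + K), (N / p : ℝ) ≤ 4 * N := by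
  have h := sum_inv_primes_le hK K
  have hK' : (K : ℝ) ≠ 0 := by exact_mod_cast hK.ne'
  rw [mul_div_cancel_right₀ _ hK'] at h
  calc ∑ p ∈ primesBetween Q K (K + K), (N / p : ℝ)
      ≤ ∑ p ∈ Finset.Ioc (2 ^ K : ℕ) (2 ^ (K + K)) with Nat.Prime p, (N / (p : ℕ) : ℝ) :=
        Finset.sum_le_sum_of_subset_of_nonneg
          (Finset.monotone_filter_right _ fun _ _ hp => hp.1) fun _ _ _ => by positivity
    _ = N * ∑ p ∈ Finset.Ioc (2 ^ K : ℕ) (2 ^ (K + K)) with Nat.Prime p, (1 / (p : ℕ) : ℝ) := by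
        rw [Finset.mul_sum]
        exact Finset.sum_congr rfl fun p _ => by ring
    _ ≤ N * 4 := by gcongr
    _ = 4 * N := mul_comm _ _

theorem sum_primesBetween_mul_two_pow_le (N Q : ℕ) {K : ℕ} (hK : 0 < K) (n : ℕ) :
    ∑ p ∈ primesBetween Q K (K * 2 ^ n), (N / p : ℝ) ≤ 4 * N * n := by
  induction n with
  | zero => simp [primesBetween]
  | succ n ih =>
    have hsub : primesBetween Q K (K * 2 ^ (n + 1)) ⊆ primesBetween Q K (K * 2 ^ n) ∪
        primesBetween Q (K * 2 ^ n) (K * 2 ^ n + K * 2 ^ n) := by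
      intro p hp
      rw [pow_succ, ← mul_assoc, mul_two] at hp
      rw [Finset.mem_union]
      obtain ⟨h1, h2, h3⟩ := mem_primesBetween.1 hp
      rcases le_or_gt p (2 ^ (K * 2 ^ n)) with h | h
      · exact Or.inl (mem_primesBetween.2 ⟨h1, h, h3⟩)
      · exact Or.inr (mem_primesBetween.2 ⟨h, h2, h3⟩)
    refine (Finset.sum_le_sum_of_subset_of_nonneg hsub fun _ _ _ => by positivity).trans ?_
    rw [Finset.sum_union (disjoint_primesBetween Q le_rfl)]
    have := sum_primesBetween_le N Q (K := K * 2 ^ n) (by positivity)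
    push_cast
    linarith

theorem prod_card_primesBetween_le {N : ℕ} (hN : N ≤ 1024) (Q r : ℕ) :
    ∏ j ∈ Finset.range r,
      (1 + ((primesBetween Q (11 * 2 ^ j) (11 * 2 ^ (j + 1))).card * N : ℕ) : ℝ) ^
        (truncLevel N r j + 1) ≤ 2 ^ (11 * 2 ^ (r + 17)) := by
  have h1 : ∀ j, 1 + (primesBetween Q (11 * 2 ^ j) (11 * 2 ^ (j + 1))).card * N
      ≤ 2 ^ (11 * 2 ^ (j + 2)) := fun j => by
    have h2 := card_primesBetween_lt Q (11 * 2 ^ j) (11 * 2 ^ (j + 1))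
    have h3 : 2 ^ 10 ≤ 2 ^ (11 * 2 ^ (j + 1)) :=
      Nat.pow_le_pow_right two_pos (by have := Nat.one_le_two_pow (n := j + 1); omega)
    rw [show 11 * 2 ^ (j + 2) = 11 * 2 ^ (j + 1) + 11 * 2 ^ (j + 1) by ring,
      pow_add 2 (11 * 2 ^ (j + 1))]
    generalize 2 ^ (11 * 2 ^ (j + 1)) = Z at *
    nlinarith
  have h2 : ∏ j ∈ Finset.range r,
      (1 + (primesBetween Q (11 * 2 ^ j) (11 * 2 ^ (j + 1))).card * N) ^ (truncLevel N r j + 1)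
        ≤ 2 ^ (11 * 2 ^ (r + 17)) := by
    calc _ ≤ ∏ j ∈ Finset.range r, 2 ^ (11 * (2 ^ (j + 2) *
            (24 * N + 3 + 2 * (r - 1 - j)))) :=
          Finset.prod_le_prod' fun j _ => by
            refine (Nat.pow_le_pow_left (h1 j) _).trans (le_of_eq ?_)
            rw [← pow_mul, truncLevel]
            congr 1
            ring
      _ = 2 ^ (11 * ∑ j ∈ Finset.range r, 2 ^ (j + 2) * (24 * N + 3 + 2 * (r - 1 - j))) := by
          rw [Finset.prod_pow_eq_pow_sum, Finset.mul_sum]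
      _ ≤ _ := by
          refine Nat.pow_le_pow_right two_pos (Nat.mul_le_mul_left _ ?_)
          have h3 := sum_two_pow_mul_level_add_le (24 * N + 3) r
          have h4 : (8 + 4 * (24 * N + 3)) * 2 ^ r ≤ 2 ^ 17 * 2 ^ r :=
            Nat.mul_le_mul_right _ (by norm_num; omega)
          rw [pow_add, mul_comm (2 ^ r)]
          omega
  exact_mod_cast h2

theorem divCount_nonneg {N : ℕ} (A B : Fin N → ℕ) (t p : ℕ) : 0 ≤ divCount A B t p :=
  Finset.sum_nonneg fun i _ => by positivity

theorem one_le_divCount {N : ℕ} {A B : Fin N → ℕ} {t p : ℕ} {i : Fin N}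
    (hp : p ∣ A i * t + B i) : 1 ≤ divCount A B t p := by
  refine le_trans ?_ (Finset.single_le_sum (fun j _ => by positivity) (Finset.mem_univ i))
  rw [if_pos hp]

theorem divCount_le_one {N : ℕ} {A B : Fin N → ℕ} {t p : ℕ}
    (hcop : ∀ i j, i ≠ j → (A i * t + B i).Coprime (A j * t + B j)) (hp : p.Prime) :
    divCount A B t p ≤ 1 := by
  rw [divCount, Finset.sum_boole]
  norm_cast
  rw [Finset.card_le_one]
  intro i hi k hk
  by_contra hik
  exact hp.one_lt.ne' (Nat.eq_one_of_dvd_coprimes (hcop i k hik)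
    (Finset.mem_filter.1 hi).2 (Finset.mem_filter.1 hk).2)

theorem sieveMinorant_primesBetween_ge {N : ℕ} (hN : N ≤ 1024) (Q r : ℕ) :
    Real.exp (-(8 * N)) ^ r / 2 ≤
      sieveMinorant N (fun j => primesBetween Q (11 * 2 ^ j) (11 * 2 ^ (j + 1))) r
        (primesBetween Q (11 * 2 ^ r) (11 * 2 ^ (r + 17))) 278528 fun p => N / p := by
  refine sieveMinorant_model_ge (fun j _ p hp => ?_) (fun j _ => ?_) (by norm_num) ?_
  · have h1 := (mem_primesBetween.1 hp).1
    have h2 : 2 ^ 11 ≤ 2 ^ (11 * 2 ^ j) :=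
      Nat.pow_le_pow_right two_pos (by have := Nat.one_le_two_pow (n := j); omega)
    omega
  · have := sum_primesBetween_le N Q (K := 11 * 2 ^ j) (by positivity)
    rwa [show 11 * 2 ^ j + 11 * 2 ^ j = 11 * 2 ^ (j + 1) by ring] at this
  · have := sum_primesBetween_mul_two_pow_le N Q (K := 11 * 2 ^ r) (by positivity) 17
    rw [mul_assoc, ← pow_add] at this
    have hN' : (N : ℝ) ≤ 1024 := by exact_mod_cast hN
    push_cast at this
    linarith

theorem sieveMinorant_norm_le {N r k m : ℕ} (hN : N ≤ 1024) (hr : r ≤ k) (hk : 2 ≤ k)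
    (hm : m ≤ 2 ^ k) : (2 : ℝ) ^ k + r * 2 ^ k + |1 / 278528| * (m * N) * 2 ^ k ≤ (2 ^ k) ^ 3 := by
  have hm' : (m : ℝ) ≤ 2 ^ k := by exact_mod_cast hm
  have hr' : (r : ℝ) ≤ 2 ^ k := by exact_mod_cast hr.trans Nat.lt_two_pow_self.le
  have hy : (2 : ℝ) ^ 2 ≤ 2 ^ k := pow_le_pow_right₀ one_le_two hk
  have hN' : (N : ℝ) / 278528 ≤ 1 := by
    have : (N : ℝ) ≤ 1024 := by exact_mod_cast hN
    linarith
  generalize (2 : ℝ) ^ k = y at *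
  have h2 : |(1 / 278528 : ℝ)| * (m * N) ≤ y := by
    rw [abs_of_pos (by norm_num)]
    calc (1 / 278528 : ℝ) * (m * N) = m * (N / 278528) := by ring
      _ ≤ y * 1 := by gcongr
      _ = y := mul_one y
  have hy0 : 0 ≤ y := by linarith
  nlinarith [mul_le_mul_of_nonneg_right h2 hy0, mul_le_mul_of_nonneg_right hr' hy0,
    mul_nonneg (sq_nonneg y) (by linarith : 0 ≤ y - 3)]

theorem le_card_sifted {N : ℕ} (hN : N ≤ 1024) {A B : Fin N → ℕ} {Q : ℕ}
    (hA : ∀ i, A i ∣ Q) (hcop : ∀ i j, i ≠ j → ∀ t, (A i * t + B i).Coprime (A j * t + B j))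
    (r X : ℕ) :
    (X : ℝ) * (Real.exp (-(8 * N)) ^ r / 2) - (2 ^ (11 * 2 ^ (r + 17))) ^ 3 ≤
      ({t ∈ Finset.range X |
        (∀ j < r, ∀ p ∈ primesBetween Q (11 * 2 ^ j) (11 * 2 ^ (j + 1)), ∀ i,
          ¬ p ∣ A i * t + B i) ∧
        ∑ p ∈ primesBetween Q (11 * 2 ^ r) (11 * 2 ^ (r + 17)), divCount A B t p < 278528}).card := by
  classical
  set P : ℕ → Finset ℕ := fun j => primesBetween Q (11 * 2 ^ j) (11 * 2 ^ (j + 1)) with hPdef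
  set M := primesBetween Q (11 * 2 ^ r) (11 * 2 ^ (r + 17)) with hMdef
  have hmono : ∀ {i j : ℕ}, i ≤ j → 11 * 2 ^ i ≤ 11 * 2 ^ j := fun h =>
    Nat.mul_le_mul_left _ (Nat.pow_le_pow_right two_pos h)
  have hdis : ∀ i < r, ∀ j < r, i ≠ j → Disjoint (P i) (P j) := fun i _ j _ hij => by
    rcases hij.lt_or_gt with h | h
    · exact disjoint_primesBetween Q (hmono h)
    · exact (disjoint_primesBetween Q (hmono h)).symm
  have hMdis : ∀ j < r, Disjoint M (P j) := fun j hj =>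
    (disjoint_primesBetween Q (hmono hj)).symm
  have hpoly := isSievePoly_sieveMinorant (N := N) (H := 278528) hdis hMdis
    (prod_card_primesBetween_le hN Q r)
  have hV : ∀ p ∈ M ∪ (Finset.range r).biUnion P, p.Prime ∧ ¬ p ∣ Q := fun p hp => by
    rcases Finset.mem_union.1 hp with hp | hp
    · exact (mem_primesBetween.1 hp).2.2
    · obtain ⟨j, -, hp⟩ := Finset.mem_biUnion.1 hp
      exact (mem_primesBetween.1 hp).2.2
  have hsum := hpoly.abs_sum_divCount_sub_le A B X (fun p hp => (hV p hp).1)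
    fun p hp i h => (hV p hp).2 (h.trans (hA i))
  have hmodel := sieveMinorant_primesBetween_ge hN Q r
  have hry : r ≤ 11 * 2 ^ (r + 17) := by
    have := (Nat.lt_two_pow_self (n := r + 17)).le
    omega
  have h2 : 2 ≤ 11 * 2 ^ (r + 17) := by
    have := Nat.one_le_two_pow (n := r + 17)
    omega
  have hnorm := sieveMinorant_norm_le hN hry h2 (card_primesBetween_lt Q (11 * 2 ^ r) _).le
  have h1 : ∀ t, ∀ j < r, ∀ p ∈ P j, divCount A B t p ≤ 1 := fun t j _ p hp =>
    divCount_le_one (fun i k hik => hcop i k hik t) (mem_primesBetween.1 hp).2.2.1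
  have hle : ∑ t ∈ Finset.range X, sieveMinorant N P r M 278528 (divCount A B t) ≤
      ({t ∈ Finset.range X | 0 < sieveMinorant N P r M 278528 (divCount A B t)}).card := by
    rw [← Finset.sum_boole]
    refine Finset.sum_le_sum fun t _ => ?_
    split_ifs with h
    · exact sieveMinorant_le_one (divCount_nonneg A B t) (h1 t) (by norm_num)
    · exact not_lt.1 h
  have hcard : ({t ∈ Finset.range X | 0 < sieveMinorant N P r M 278528 (divCount A B t)}).card ≤
      ({t ∈ Finset.range X | (∀ j < r, ∀ p ∈ P j, ∀ i, ¬ p ∣ A i * t + B i) ∧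
        ∑ p ∈ M, divCount A B t p < 278528}).card := by
    refine Finset.card_le_card (Finset.monotone_filter_right _ fun t _ ht => ?_)
    obtain ⟨h2, h3⟩ := of_sieveMinorant_pos (divCount_nonneg A B t) (h1 t) (by norm_num) ht
    exact ⟨fun j hj p hp i hdvd => absurd (one_le_divCount hdvd) (h2 j hj p hp).not_ge, h3⟩
  have hcard' := hle.trans (Nat.cast_le.2 hcard)
  have h4 := (abs_le.1 hsum).1
  have h3 := mul_le_mul_of_nonneg_left hmodel (Nat.cast_nonneg X : (0 : ℝ) ≤ X)
  linarith

theorem card_sq_dvd_le {N : ℕ} (A B : Fin N → ℕ) (X : ℕ) {z w : ℕ} (hz : 0 < z) (hzw : z ≤ w)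
    {P : Finset ℕ} (hP : P ⊆ Finset.Ioc z w) (hp : ∀ p ∈ P, p.Prime)
    (hA : ∀ p ∈ P, ∀ i, ¬ p ∣ A i) :
    (({t ∈ Finset.range X | ∃ i, ∃ p ∈ P, p ^ 2 ∣ A i * t + B i}).card : ℝ) ≤ N * (X / z + w) := by
  classical
  have hsub : {t ∈ Finset.range X | ∃ i, ∃ p ∈ P, p ^ 2 ∣ A i * t + B i} ⊆
      Finset.univ.biUnion fun i => P.biUnion fun p =>
        {t ∈ Finset.range X | p ^ 2 ∣ A i * t + B i} := by
    intro t ht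
    obtain ⟨ht, i, p, hpP, hdvd⟩ := Finset.mem_filter.1 ht
    simp only [Finset.mem_biUnion, Finset.mem_filter, Finset.mem_univ, true_and]
    exact ⟨i, p, hpP, ht, hdvd⟩
  have hcard : ∀ i, ∀ p ∈ P,
      (({t ∈ Finset.range X | p ^ 2 ∣ A i * t + B i}).card : ℝ) ≤ X * ((p : ℝ) ^ 2)⁻¹ + 1 := by
    intro i p hpP
    have hpp := hp p hpP
    obtain ⟨c, hc⟩ := exists_root_modEq (pow_ne_zero 2 hpp.ne_zero)
      (((hpp.coprime_iff_not_dvd.2 (hA p hpP i)).symm).pow_right 2) (B i)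
    have h := (abs_le.1 (abs_count_modEq_sub_le (pow_pos hpp.pos 2) c X)).2
    rw [Finset.sum_boole] at h
    simp only [hc]
    push_cast at h
    rw [div_eq_mul_inv] at h
    linarith
  have hinv : ∑ p ∈ P, ((p : ℝ) ^ 2)⁻¹ ≤ (z : ℝ)⁻¹ :=
    (Finset.sum_le_sum_of_subset_of_nonneg hP fun _ _ _ => by positivity).trans <|
      (sum_Ioc_inv_sq_le_sub hz.ne' hzw).trans (sub_le_self _ (by positivity))
  have hPw : (P.card : ℝ) ≤ w := by
    have := Finset.card_le_card hP
    rw [Nat.card_Ioc] at this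
    exact_mod_cast this.trans (Nat.sub_le _ _)
  calc _ ≤ ∑ i : Fin N, ∑ p ∈ P,
          (({t ∈ Finset.range X | p ^ 2 ∣ A i * t + B i}).card : ℝ) := by
        have h := (Finset.card_le_card hsub).trans (Finset.card_biUnion_le.trans
          (Finset.sum_le_sum fun i _ => Finset.card_biUnion_le))
        exact_mod_cast h
    _ ≤ ∑ i : Fin N, ∑ p ∈ P, (X * ((p : ℝ) ^ 2)⁻¹ + 1) :=
        Finset.sum_le_sum fun i _ => Finset.sum_le_sum (hcard i)
    _ = N * (X * ∑ p ∈ P, ((p : ℝ) ^ 2)⁻¹ + P.card) := by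
        simp [Finset.sum_add_distrib, ← Finset.mul_sum, mul_add]
    _ ≤ N * (X / z + w) := by
        rw [div_eq_mul_inv]
        gcongr

theorem le_two_pow_mul_exp_pow {N r : ℕ} (hN : N ≤ 1024) (hr : 20 ≤ r) :
    8192 ≤ (2 : ℝ) ^ (11 * 2 ^ r) * Real.exp (-(8 * N)) ^ r := by
  have hr' : 13 + 12288 * r ≤ 11 * 2 ^ r := by
    induction r, hr using Nat.le_induction with
    | base => norm_num
    | succ r hr ih =>
      rw [pow_succ]
      omega
  have hexp : Real.exp (8 * N) ^ r ≤ 2 ^ (12288 * r) := by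
    rw [pow_mul]
    gcongr
    have h := exp_two_mul_le_two_pow (4 * N)
    rw [show (2 : ℝ) * (4 * N : ℕ) = 8 * N by push_cast; ring] at h
    exact h.trans (pow_le_pow_right₀ one_le_two (by omega))
  rw [Real.exp_neg, inv_pow, ← div_eq_mul_inv, le_div_iff₀ (by positivity)]
  calc 8192 * Real.exp (8 * N) ^ r ≤ 2 ^ 13 * 2 ^ (12288 * r) := by
        gcongr
        norm_num
    _ = 2 ^ (13 + 12288 * r) := (pow_add _ _ _).symm
    _ ≤ _ := pow_le_pow_right₀ one_le_two hr'

theorem sieve_main_term_gt {N T : ℕ} {z y δ : ℝ} (hN : N ≤ 1024) (hz : 0 < z) (hzy : z ≤ y)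
    (hδ : 8192 ≤ z * δ) (hy : 1 ≤ y) (hT : T ≤ y) :
    T + N * (y ^ 4 / z + y ^ 3) < y ^ 4 * (δ / 2) - y ^ 3 := by
  have hN' : (N : ℝ) ≤ 1024 := by exact_mod_cast hN
  have hδ0 : 0 < δ := pos_of_mul_pos_right (by linarith : 0 < z * δ) hz.le
  have hδz : 8192 / z ≤ δ := (div_le_iff₀' hz).2 hδ
  have hδy : 8192 ≤ y * δ := hδ.trans (by gcongr)
  have hy3 : 1 ≤ y ^ 3 := one_le_pow₀ hy
  have h1 : N * (y ^ 4 / z) ≤ y ^ 4 * (δ / 8) := by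
    calc N * (y ^ 4 / z) ≤ 1024 * (y ^ 4 / z) := by gcongr
      _ = y ^ 4 * (8192 / z / 8) := by ring
      _ ≤ _ := by gcongr
  have h2 : N * y ^ 3 ≤ 1024 * y ^ 3 := by gcongr
  have h3 : 8192 * y ^ 3 ≤ y ^ 4 * δ := by
    calc 8192 * y ^ 3 ≤ y * δ * y ^ 3 := by gcongr
      _ = _ := by ring
  have h4 : y ≤ y ^ 3 := le_self_pow₀ hy (by norm_num)
  linarith

theorem exists_sifted {N : ℕ} (hN : N ≤ 1024) {A B : Fin N → ℕ} {Q : ℕ}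
    (hA : ∀ i, A i ∣ Q) (hcop : ∀ i j, i ≠ j → ∀ t, (A i * t + B i).Coprime (A j * t + B j))
    (hpos : ∀ i t, 0 < A i * t + B i) (T : ℕ) :
    ∃ r t, T ≤ t ∧ (∀ i, A i * t + B i ≤ (2 ^ (11 * 2 ^ (r + 17))) ^ 5) ∧
      (∀ j < r, ∀ p ∈ primesBetween Q (11 * 2 ^ j) (11 * 2 ^ (j + 1)), ∀ i,
        ¬ p ∣ A i * t + B i) ∧
      ∑ p ∈ primesBetween Q (11 * 2 ^ r) (11 * 2 ^ (r + 17)), divCount A B t p < 278528 ∧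
      ∀ i p, p.Prime → ¬ p ∣ Q → 2 ^ (11 * 2 ^ r) < p → ¬ p ^ 2 ∣ A i * t + B i := by
  classical
  set r := 20 + T + ∑ i, (A i + B i) with hr
  set a := 11 * 2 ^ r with ha
  set b := 11 * 2 ^ (r + 17) with hb
  have hab : a ≤ b := Nat.mul_le_mul_left _ (Nat.pow_le_pow_right two_pos (Nat.le_add_right _ _))
  have hrb : r ≤ 2 ^ b := by
    have h1 : r < 2 ^ r := Nat.lt_two_pow_self
    have h2 : b < 2 ^ b := Nat.lt_two_pow_self
    omega
  have hcount := le_card_sifted hN hA hcop r ((2 ^ b) ^ 4)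
  set S := {t ∈ Finset.range ((2 ^ b) ^ 4) |
    (∀ j < r, ∀ p ∈ primesBetween Q (11 * 2 ^ j) (11 * 2 ^ (j + 1)), ∀ i,
      ¬ p ∣ A i * t + B i) ∧ ∑ p ∈ primesBetween Q a b, divCount A B t p < 278528} with hS
  have hbad := card_sq_dvd_le A B ((2 ^ b) ^ 4) (z := 2 ^ a) (w := (2 ^ b) ^ 3)
    (P := primesBetween Q a (b * 3)) (by positivity)
    (by rw [← pow_mul]; exact Nat.pow_le_pow_right two_pos (by omega))
    (by rw [← pow_mul]; exact Finset.filter_subset _ _)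
    (fun p hp => (mem_primesBetween.1 hp).2.2.1)
    (fun p hp i h => (mem_primesBetween.1 hp).2.2.2 (h.trans (hA i)))
  set E := {t ∈ Finset.range ((2 ^ b) ^ 4) | ∃ i, ∃ p ∈ primesBetween Q a (b * 3),
    p ^ 2 ∣ A i * t + B i} with hE
  have hmain := sieve_main_term_gt (T := T) (z := 2 ^ a) (y := 2 ^ b)
    (δ := Real.exp (-(8 * N)) ^ r) hN (by positivity) (pow_le_pow_right₀ one_le_two hab)
    (le_two_pow_mul_exp_pow hN (by omega)) (one_le_pow₀ one_le_two)
    (by exact_mod_cast (by omega : T ≤ r).trans hrb)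
  have hlt : (Finset.range T ∪ E).card < S.card := by
    have h1 : ((Finset.range T ∪ E).card : ℝ) ≤ T + E.card := by
      have := Finset.card_union_le (Finset.range T) E
      rw [Finset.card_range] at this
      exact_mod_cast this
    have h2 : ((Finset.range T ∪ E).card : ℝ) < S.card := by
      push_cast at hbad hcount
      linarith
    exact_mod_cast h2
  obtain ⟨t, htS, htE⟩ := Finset.exists_mem_notMem_of_card_lt_card hlt
  rw [Finset.mem_union, not_or, Finset.mem_range, not_lt] at htE
  obtain ⟨htX, ht1, ht2⟩ := Finset.mem_filter.1 htS
  have htX' := Finset.mem_range.1 htX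
  have hbound : ∀ i, A i * t + B i ≤ (2 ^ b) ^ 5 := fun i => by
    have h1 : A i + B i ≤ ∑ i, (A i + B i) :=
      Finset.single_le_sum (f := fun i => A i + B i) (fun _ _ => Nat.zero_le _)
        (Finset.mem_univ i)
    have h2 : A i + B i ≤ 2 ^ b := by omega
    have h3 : 1 ≤ (2 ^ b) ^ 4 := Nat.one_le_pow _ _ (by positivity)
    calc A i * t + B i ≤ A i * (2 ^ b) ^ 4 + B i * (2 ^ b) ^ 4 :=
          add_le_add (Nat.mul_le_mul_left _ htX'.le) (Nat.le_mul_of_pos_right _ h3)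
      _ = (A i + B i) * (2 ^ b) ^ 4 := by ring
      _ ≤ 2 ^ b * (2 ^ b) ^ 4 := Nat.mul_le_mul_right _ h2
      _ = _ := by rw [← pow_succ']
  refine ⟨r, t, htE.1, hbound, ht1, ht2, fun i p hp hpQ hpa hdvd => htE.2 ?_⟩
  refine Finset.mem_filter.2 ⟨htX, i, p, mem_primesBetween.2 ⟨hpa, ?_, hp, hpQ⟩, hdvd⟩
  have h1 := (Nat.le_of_dvd (hpos i t) hdvd).trans (hbound i)
  refine le_of_not_gt fun h => h1.not_gt ?_
  calc (2 ^ b) ^ 5 ≤ (2 ^ (b * 3)) ^ 2 := by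
        rw [← pow_mul, ← pow_mul]
        exact Nat.pow_le_pow_right two_pos (by omega)
    _ < p ^ 2 := Nat.pow_lt_pow_left h (by norm_num)

theorem sum_range_card_le_sum (s : Finset ℕ) : ∑ k ∈ Finset.range s.card, k ≤ ∑ k ∈ s, k := by
  induction s using Finset.induction_on_max with
  | empty => simp
  | insert a s ha ih =>
    have has : a ∉ s := fun h => lt_irrefl _ (ha a h)
    have hsa : s.card ≤ a := by
      simpa using Finset.card_le_card (fun x hx => Finset.mem_range.2 (ha x hx) :
        s ⊆ Finset.range a)
    rw [Finset.card_insert_of_notMem has, Finset.sum_range_succ, Finset.sum_insert has]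
    omega

theorem d_eq_two_pow {n : ℕ} (hn : n ≠ 0) (h : ∀ p, p.Prime → ¬ p ^ 2 ∣ n) :
    d n = 2 ^ n.primeFactors.card := by
  rw [d, Nat.card_divisors hn, ← Finset.prod_const]
  refine Finset.prod_congr rfl fun p hp => ?_
  have hpp := Nat.prime_of_mem_primeFactors hp
  have h1 : n.factorization p < 2 :=
    lt_of_not_ge fun h2 => h p hpp ((hpp.pow_dvd_iff_le_factorization hn).2 h2)
  have h2 : 0 < n.factorization p :=
    hpp.factorization_pos_of_dvd hn (Nat.dvd_of_mem_primeFactors hp)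
  omega

theorem exists_lt_le_succ {f : ℕ → ℕ} {p r : ℕ} (h0 : f 0 < p) (hr : p ≤ f r) :
    ∃ j < r, f j < p ∧ p ≤ f (j + 1) := by
  induction r with
  | zero => omega
  | succ r ih =>
    rcases le_or_gt p (f r) with h | h
    · obtain ⟨j, hj, h'⟩ := ih h
      exact ⟨j, by omega, h'⟩
    · exact ⟨r, by omega, h, hr⟩

theorem card_primeFactors_gt_le {n y k : ℕ} (hy : 1 < y) (hn : 0 < n) (h : n ≤ y ^ k) :
    ({p ∈ n.primeFactors | y < p}).card ≤ k := by
  refine (Nat.pow_le_pow_iff_right hy).1 (le_trans ?_ h)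
  rw [← Finset.prod_const]
  calc _ ≤ ∏ p ∈ n.primeFactors with y < p, p :=
        Finset.prod_le_prod' fun p hp => (Finset.mem_filter.1 hp).2.le
    _ ≤ ∏ p ∈ n.primeFactors, p :=
        Finset.prod_le_prod_of_subset_of_one_le' (Finset.filter_subset _ _) fun p hp _ =>
          (Nat.prime_of_mem_primeFactors hp).one_lt.le
    _ ≤ n := Nat.le_of_dvd hn (Nat.prod_primeFactors_dvd n)

/-- Among `1024` pairwise coprime linear forms with no small fixed prime divisors, two take values
with equally many divisors infinitely often. -/
theorem exists_d_eq {A B : Fin 1024 → ℕ} {Q : ℕ} (hA : ∀ i, A i ∣ Q)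
    (hQ : ∀ p, p.Prime → p ≤ 2048 → p ∣ Q) (hAB : ∀ i t, (A i * t + B i).Coprime Q)
    (hcop : ∀ i j, i ≠ j → ∀ t, (A i * t + B i).Coprime (A j * t + B j)) (T : ℕ) :
    ∃ t, T ≤ t ∧ ∃ i j, i ≠ j ∧ d (A i * t + B i) = d (A j * t + B j) := by
  have hnd : ∀ i t p, p.Prime → p ∣ A i * t + B i → ¬ p ∣ Q := fun i t p hp h hQ' =>
    hp.one_lt.ne' (Nat.eq_one_of_dvd_coprimes (hAB i t) h hQ')
  have hpos : ∀ i t, 0 < A i * t + B i := fun i t => Nat.pos_of_ne_zero fun h =>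
    hnd i t 2 Nat.prime_two (h ▸ dvd_zero 2) (hQ 2 Nat.prime_two (by norm_num))
  obtain ⟨r, t, hT, hbound, hsift, hmid, hsq⟩ := exists_sifted le_rfl hA hcop hpos T
  refine ⟨t, hT, ?_⟩
  set M := primesBetween Q (11 * 2 ^ r) (11 * 2 ^ (r + 17)) with hM
  have hlarge : ∀ i p, p.Prime → p ∣ A i * t + B i → 2 ^ (11 * 2 ^ r) < p := fun i p hp hdvd => by
    by_contra hle
    obtain ⟨j, hj, h1, h2⟩ := exists_lt_le_succ (f := fun j => 2 ^ (11 * 2 ^ j)) (p := p)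
      (lt_of_not_ge fun h => hnd i t p hp hdvd (hQ p hp (by simpa using h))) (not_lt.1 hle)
    exact hsift j hj p (mem_primesBetween.2 ⟨h1, h2, hp, hnd i t p hp hdvd⟩) i hdvd
  have hd : ∀ i, d (A i * t + B i) = 2 ^ (A i * t + B i).primeFactors.card := fun i =>
    d_eq_two_pow (hpos i t).ne' fun p hp hdvd => by
      have hdvd' := (dvd_pow_self p two_ne_zero).trans hdvd
      exact hsq i p hp (hnd i t p hp hdvd') (hlarge i p hp hdvd') hdvd
  have hω : ∀ i, (A i * t + B i).primeFactors.card ≤ 5 + ({p ∈ M | p ∣ A i * t + B i}).card := by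
    intro i
    have h1 : 1 < 2 ^ (11 * 2 ^ (r + 17)) := Nat.one_lt_two_pow (by positivity)
    rw [← Finset.card_filter_add_card_filter_not (fun p => 2 ^ (11 * 2 ^ (r + 17)) < p)]
    refine add_le_add (card_primeFactors_gt_le h1 (hpos i t) (hbound i))
      (Finset.card_le_card fun p hp => ?_)
    obtain ⟨h2, h3⟩ := Finset.mem_filter.1 hp
    have hpp := Nat.prime_of_mem_primeFactors h2
    have hdvd := Nat.dvd_of_mem_primeFactors h2
    exact Finset.mem_filter.2 ⟨mem_primesBetween.2
      ⟨hlarge i p hpp hdvd, not_lt.1 h3, hpp, hnd i t p hpp hdvd⟩, hdvd⟩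
  have hsumM : ∑ i, ({p ∈ M | p ∣ A i * t + B i}).card < 278528 := by
    have h1 : (∑ i, ({p ∈ M | p ∣ A i * t + B i}).card : ℝ) = ∑ p ∈ M, divCount A B t p := by
      simp only [divCount]
      rw [Finset.sum_comm]
      exact Finset.sum_congr rfl fun i _ => (Finset.sum_boole _ _).symm
    rw [← h1] at hmid
    exact_mod_cast hmid
  by_contra! hne
  have hinj : Function.Injective fun i => (A i * t + B i).primeFactors.card := fun i j hij => by
    by_contra h
    refine hne i j h ?_
    rw [hd, hd]
    exact congrArg (2 ^ ·) hij
  have h1 := sum_range_card_le_sum (Finset.univ.image fun i => (A i * t + B i).primeFactors.card)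
  rw [Finset.card_image_of_injective _ hinj, Finset.sum_image fun i _ j _ h => hinj h,
    Finset.card_univ, Fintype.card_fin, Finset.sum_range_id] at h1
  have h2 := h1.trans (Finset.sum_le_sum fun i _ => hω i)
  rw [Finset.sum_add_distrib, Finset.sum_const, Finset.card_univ, Fintype.card_fin,
    smul_eq_mul] at h2
  omega

theorem exists_gt_ratio_eq {q : ℚ} (hq : 0 < q) (b : ℕ) :
    ∃ n, b < n ∧ (d (n + 1) : ℚ) / (d n : ℚ) = q := by
  obtain ⟨X, w, h⟩ := exists_isBalanced hq 1024
  obtain ⟨k, K, hK, hk⟩ := exists_nat_mul_eq_const w h.weight_pos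
  obtain ⟨R, hR0, hR⟩ : ∃ R : ℕ, 0 < R ∧ ∀ p, p.Prime → p ≤ 2048 → p ∣ R :=
    ⟨_, Nat.factorial_pos 2048, fun p hp hle => Nat.dvd_factorial hp.pos hle⟩
  obtain ⟨p, A, B, Y, Q, hQ0, hRQ, hp, -, hpR, hpQ, hAQ, hval, hABQ⟩ :=
    exists_shift h.pos h.inj h.dvd (fun i => k i - 1) (fun i => by have := (hk i).1; omega) hR0
  have hXQ : ∏ k, X k ∣ Q := (Dvd.intro_left R rfl).trans hRQ
  have hXi : ∀ i, X i ∣ ∏ k, X k := fun i => Finset.dvd_prod_of_mem X (Finset.mem_univ i)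
  have hcop : ∀ i j, i ≠ j → ∀ t, (A i * t + B i).Coprime (A j * t + B j) := fun i j hij t =>
    coprime_cofactors h.inj h.dvd hXQ (fun i => hval i t) (fun i => hABQ i t) hij
  obtain ⟨t, hbt, i, j, hij, hd⟩ := exists_d_eq hAQ
    (fun p hp hle => (hR p hp hle).trans ((Dvd.intro _ rfl).trans hRQ)) hABQ hcop b
  wlog hlt : X i < X j generalizing i j
  · exact this j i hij.symm hd.symm
      (lt_of_le_of_ne (not_lt.1 hlt) fun he => hij (h.inj he).symm)
  have hpcop : ∀ i, (p i).Coprime (A i * t + B i) := fun i =>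
    ((hABQ i t).coprime_dvd_right (hpQ i)).symm
  have hXval : ∀ i, 0 < X i + (Y + t * Q) := fun i => Nat.add_pos_left (h.pos i) _
  have hshift := h.shift (Y := Y + t * Q) (u := fun i => p i ^ (k i - 1) * (A i * t + B i))
    (fun i => by rw [hval, mul_assoc])
    (fun i => Nat.Coprime.mul_right
      (((hpR i).coprime_dvd_right ((hXi i).trans (Dvd.intro_left R rfl))).symm.pow_right _)
      ((hABQ i t).coprime_dvd_right ((hXi i).trans hXQ)).symm)
    fun i => Nat.pos_of_ne_zero fun h0 => (hXval i).ne' (by rw [hval, mul_assoc, h0, mul_zero])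
  have hweight : ∀ i, w i * d (p i ^ (k i - 1) * (A i * t + B i)) = K * d (A i * t + B i) := by
    intro i
    have hk1 := (hk i).1
    rw [d_mul_of_coprime ((hpcop i).pow_left _), d_prime_pow (hp i), Nat.sub_add_cancel (by omega),
      ← (hk i).2]
    push_cast
    ring
  have hlt' : X i + (Y + t * Q) < X j + (Y + t * Q) := Nat.add_lt_add_right hlt _
  have hratio := hshift.ratio i j hlt'
  obtain ⟨n, hn⟩ := hshift.dvd i j hlt'
  simp only [hweight, hd] at hratio
  rw [Nat.add_sub_add_right] at hn hratio
  have hg : 0 < X j - X i := Nat.sub_pos_of_lt hlt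
  have hnj : X j + (Y + t * Q) = (X j - X i) * (n + 1) := by
    rw [mul_add, mul_one, ← hn]
    omega
  rw [hnj, hn, Nat.mul_div_cancel_left _ hg, Nat.mul_div_cancel_left _ hg] at hratio
  have hgQ : X j - X i ≤ Q :=
    Nat.le_of_dvd hQ0 ((h.dvd i j hlt).trans ((hXi i).trans hXQ))
  have hbn : b < n := by
    refine hbt.trans_lt (Nat.lt_of_mul_lt_mul_left (a := X j - X i) ?_)
    rw [← hn, mul_comm]
    have := Nat.mul_le_mul_left t hgQ
    have := h.pos i
    omega
  refine ⟨n, hbn, ?_⟩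
  have hdn : (d n : ℚ) ≠ 0 := by exact_mod_cast (d_pos (by omega : 0 < n)).ne'
  have hdL : (d (A j * t + B j) : ℚ) ≠ 0 := by
    have : 0 < A j * t + B j := Nat.pos_of_ne_zero fun h0 =>
      (hXval j).ne' (by rw [hval, h0, mul_zero])
    exact_mod_cast (d_pos this).ne'
  rw [div_eq_iff hdn]
  refine mul_right_cancel₀ (mul_ne_zero hK.ne' hdL) (hratio.trans ?_)
  ring

/-- For every positive rational number `q` there are infinitely many positive
integers `n` such that `d(n+1)/d(n) = q`. -/
theorem stmt_0 (q : ℚ) (hq : 0 < q) :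
    {n : ℕ | 0 < n ∧ (d (n + 1) : ℚ) / (d n : ℚ) = q}.Infinite := by
  refine Set.infinite_of_forall_exists_gt fun b => ?_
  obtain ⟨n, hbn, hn⟩ := exists_gt_ratio_eq hq b
  exact ⟨n, ⟨by omega, hn⟩, hbn⟩
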